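/- For every integer n ≥ 3 there exists a C^∞-smooth embedding i : S^{2n−1} → ℝ^{2n} such that the restriction of the standard symplectic form ω to i(S^{2n−1}) has no closed characteristics: there is no nonconstant periodic smooth curve γ : ℝ → ℝ^{2n} with γ(t) ∈ i(S^{2n−1}), γ'(t) ≠ 0, and ω(γ'(t), v) = 0 for every t and every vector v tangent to i(S^{2n−1}) at γ(t). -/

import Mathlib

open scoped RealInnerProductSpace

/-- The standard symplectic form on `ℝ^{2n} = ℂ^n`: `ω(u, v) = ⟨iu, v⟩`. -/
noncomputable def stdSymp (n : ℕ) (u v : EuclideanSpace ℂ (Fin n)) : ℝ :=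
  ⟪(Complex.I • u : EuclideanSpace ℂ (Fin n)), v⟫

namespace HamiltonianSeifert

open Filter Topology Set

/-! ### One-variable profiles -/

/-- A smooth antitone cutoff, equal to `1` exactly on `(-∞, 0]` and to `0` exactly on `[1, ∞)`. -/
noncomputable def beta (x : ℝ) : ℝ := Real.smoothTransition (1 - x)

lemma beta_nonneg (x : ℝ) : 0 ≤ beta x := Real.smoothTransition.nonneg _

lemma beta_le_one (x : ℝ) : beta x ≤ 1 := Real.smoothTransition.le_one _

lemma beta_zero : beta 0 = 1 := by simp [beta]

lemma beta_lt_one {x : ℝ} (hx : 0 < x) : beta x < 1 :=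
  Real.smoothTransition.lt_one_of_lt_one (by linarith)

lemma beta_eq_zero {x : ℝ} (hx : 1 ≤ x) : beta x = 0 :=
  Real.smoothTransition.zero_of_nonpos (by linarith)

lemma beta_antitone : Antitone beta := fun _ _ h =>
  Real.smoothTransition.monotone (by linarith)

lemma contDiff_beta {m : ℕ∞} : ContDiff ℝ m beta :=
  Real.smoothTransition.contDiff.comp (contDiff_const.sub contDiff_id)

lemma hasDerivAt_beta (x : ℝ) : HasDerivAt beta (deriv beta x) x :=
  ((contDiff_beta (m := 1)).differentiable (by simp) x).hasDerivAt

lemma continuous_deriv_beta : Continuous (deriv beta) :=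
  (contDiff_beta (m := 1)).continuous_deriv (by simp)

lemma deriv_beta_nonpos (x : ℝ) : deriv beta x ≤ 0 := beta_antitone.deriv_nonpos

lemma deriv_beta_eq_zero {x : ℝ} (hx : 1 ≤ x) : deriv beta x = 0 := by
  apply IsLocalMin.deriv_eq_zero
  exact Filter.Eventually.of_forall fun y => by rw [beta_eq_zero hx]; exact beta_nonneg y

lemma eq_zero_of_beta_eq_one {x : ℝ} (hx : 0 ≤ x) (h : beta x = 1) : x = 0 := by
  by_contra hne
  exact (beta_lt_one (lt_of_le_of_ne hx (Ne.symm hne))).ne h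

/-- An odd compactly supported profile whose derivative is at most `1`, with equality only at
the origin. -/
noncomputable def psi (ρ y : ℝ) : ℝ := y * beta (y ^ 2 / ρ ^ 2)

lemma contDiff_psi {ρ : ℝ} {m : ℕ∞} : ContDiff ℝ m (psi ρ) :=
  contDiff_id.mul (contDiff_beta.comp ((contDiff_id.pow 2).div_const _))

/-- The derivative of `psi`. -/
noncomputable def dpsi (ρ y : ℝ) : ℝ :=
  beta (y ^ 2 / ρ ^ 2) + y * (deriv beta (y ^ 2 / ρ ^ 2) * (2 * y / ρ ^ 2))

lemma hasDerivAt_psi (ρ y : ℝ) : HasDerivAt (psi ρ) (dpsi ρ y) y := by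
  have h1 : HasDerivAt (fun y : ℝ => y ^ 2 / ρ ^ 2) (2 * y / ρ ^ 2) y := by
    simpa using (hasDerivAt_pow 2 y).div_const (ρ ^ 2)
  have h2 : HasDerivAt (fun y : ℝ => beta (y ^ 2 / ρ ^ 2))
      (deriv beta (y ^ 2 / ρ ^ 2) * (2 * y / ρ ^ 2)) y :=
    HasDerivAt.comp (h₂ := beta) y (hasDerivAt_beta (y ^ 2 / ρ ^ 2)) h1
  have := (hasDerivAt_id' y).fun_mul h2
  rwa [one_mul] at this

lemma continuous_psi {ρ : ℝ} : Continuous (psi ρ) := (contDiff_psi (m := 0)).continuous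

lemma continuous_dpsi {ρ : ℝ} : Continuous (dpsi ρ) := by
  have h1 := (contDiff_beta (m := 0)).continuous
  have h2 := continuous_deriv_beta
  unfold dpsi
  fun_prop

lemma dpsi_le_beta (ρ y : ℝ) : dpsi ρ y ≤ beta (y ^ 2 / ρ ^ 2) := by
  have h : y * (deriv beta (y ^ 2 / ρ ^ 2) * (2 * y / ρ ^ 2))
      = deriv beta (y ^ 2 / ρ ^ 2) * (2 * (y ^ 2 / ρ ^ 2)) := by ring
  have h2 : 0 ≤ 2 * (y ^ 2 / ρ ^ 2) := by positivity
  have := mul_nonpos_of_nonpos_of_nonneg (deriv_beta_nonpos (y ^ 2 / ρ ^ 2)) h2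
  unfold dpsi
  linarith

lemma dpsi_le_one (ρ y : ℝ) : dpsi ρ y ≤ 1 := (dpsi_le_beta ρ y).trans (beta_le_one _)

lemma eq_zero_of_dpsi_eq_one {ρ y : ℝ} (hρ : 0 < ρ) (h : dpsi ρ y = 1) : y = 0 := by
  have h1 : beta (y ^ 2 / ρ ^ 2) = 1 :=
    le_antisymm (beta_le_one _) (h ▸ dpsi_le_beta ρ y)
  have h2 := eq_zero_of_beta_eq_one (by positivity) h1
  have h3 : ρ ^ 2 ≠ 0 := by positivity
  simpa [h3, hρ.ne'] using h2

@[simp] lemma psi_zero (ρ : ℝ) : psi ρ 0 = 0 := by simp [psi]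

@[simp] lemma dpsi_zero (ρ : ℝ) : dpsi ρ 0 = 1 := by simp [dpsi, beta_zero]

lemma one_le_sq_div_sq {ρ y : ℝ} (hρ : 0 < ρ) (h : ρ ≤ |y|) : 1 ≤ y ^ 2 / ρ ^ 2 := by
  rw [le_div_iff₀ (by positivity), one_mul, ← sq_abs y]
  gcongr

lemma psi_eq_zero {ρ y : ℝ} (hρ : 0 < ρ) (h : ρ ≤ |y|) : psi ρ y = 0 := by
  simp [psi, beta_eq_zero (one_le_sq_div_sq hρ h)]

lemma dpsi_eq_zero {ρ y : ℝ} (hρ : 0 < ρ) (h : ρ ≤ |y|) : dpsi ρ y = 0 := by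
  simp [dpsi, beta_eq_zero (one_le_sq_div_sq hρ h), deriv_beta_eq_zero (one_le_sq_div_sq hρ h)]

lemma abs_psi_le {ρ : ℝ} (hρ : 0 < ρ) (y : ℝ) : |psi ρ y| ≤ ρ := by
  by_cases h : ρ ≤ |y|
  · simp [psi_eq_zero hρ h, hρ.le]
  · rw [psi, abs_mul, abs_of_nonneg (beta_nonneg _)]
    exact (mul_le_of_le_one_right (abs_nonneg _) (beta_le_one _)).trans (not_le.1 h).le

/-- For `κ ∈ [0, 1]` the map `y ↦ y - κ ψ(y)` is strictly increasing. -/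
lemma strictMono_sub_psi {ρ κ : ℝ} (hρ : 0 < ρ) (h0 : 0 ≤ κ) (h1 : κ ≤ 1) :
    StrictMono fun y => y - κ * psi ρ y := by
  have key : ∀ y, y - κ * psi ρ y = y * (1 - κ * beta (y ^ 2 / ρ ^ 2)) := by
    intro y; simp only [psi]; ring
  have odd : ∀ y, (-y) - κ * psi ρ (-y) = -(y - κ * psi ρ y) := by
    intro y; simp only [psi, neg_sq]; ring
  have pos : ∀ y, 0 < y → 0 < 1 - κ * beta (y ^ 2 / ρ ^ 2) := by
    intro y hy
    have hb := beta_lt_one (x := y ^ 2 / ρ ^ 2) (by positivity)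
    nlinarith [beta_nonneg (y ^ 2 / ρ ^ 2)]
  have mono : ∀ x y, 0 ≤ x → x < y → x - κ * psi ρ x < y - κ * psi ρ y := by
    intro x y hx hxy
    rw [key, key]
    have hy := pos y (hx.trans_lt hxy)
    have hb : beta (y ^ 2 / ρ ^ 2) ≤ beta (x ^ 2 / ρ ^ 2) := beta_antitone (by gcongr)
    calc x * (1 - κ * beta (x ^ 2 / ρ ^ 2)) ≤ x * (1 - κ * beta (y ^ 2 / ρ ^ 2)) := by gcongr
      _ < y * (1 - κ * beta (y ^ 2 / ρ ^ 2)) := by gcongr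
  intro x y hxy
  rcases le_or_gt 0 x with hx | hx
  · exact mono x y hx hxy
  · rcases le_or_gt y 0 with hy | hy
    · have := mono (-y) (-x) (by linarith) (by linarith)
      rw [odd, odd] at this
      simp only
      linarith
    · have a1 := mono 0 (-x) le_rfl (by linarith)
      have a2 := mono 0 y le_rfl hy
      rw [odd] at a1
      simp only [psi_zero] at a1 a2 ⊢
      linarith

lemma exists_sub_psi_eq {ρ κ : ℝ} (hρ : 0 < ρ) (h0 : 0 ≤ κ) (h1 : κ ≤ 1) (ξ : ℝ) :
    ∃ y, y - κ * psi ρ y = ξ := by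
  have hc : Continuous fun y => y - κ * psi ρ y :=
    continuous_id.sub (continuous_const.mul continuous_psi)
  have hb : ∀ y, |κ * psi ρ y| ≤ ρ := fun y => by
    rw [abs_mul, abs_of_nonneg h0]
    exact (mul_le_of_le_one_left (abs_nonneg _) h1).trans (abs_psi_le hρ y)
  have := intermediate_value_Icc (a := ξ - ρ) (b := ξ + ρ) (by linarith) hc.continuousOn
  obtain ⟨y, -, hy⟩ := @this ξ ⟨by
    have := (abs_le.1 (hb (ξ - ρ))).1; linarith, by
    have := (abs_le.1 (hb (ξ + ρ))).2; linarith⟩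
  exact ⟨y, hy⟩

open Classical in
/-- The solution `y` of `y - κ ψ(y) = ξ`. -/
noncomputable def sol (ρ κ ξ : ℝ) : ℝ :=
  if h : ∃ y, y - κ * psi ρ y = ξ then h.choose else 0

lemma sol_spec {ρ κ : ℝ} (hρ : 0 < ρ) (h0 : 0 ≤ κ) (h1 : κ ≤ 1) (ξ : ℝ) :
    sol ρ κ ξ - κ * psi ρ (sol ρ κ ξ) = ξ := by
  have h := exists_sub_psi_eq hρ h0 h1 ξ
  rw [sol, dif_pos h]
  exact h.choose_spec

lemma sol_eq {ρ κ ξ y : ℝ} (hρ : 0 < ρ) (h0 : 0 ≤ κ) (h1 : κ ≤ 1)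
    (h : y - κ * psi ρ y = ξ) : sol ρ κ ξ = y :=
  (strictMono_sub_psi hρ h0 h1).injective ((sol_spec hρ h0 h1 ξ).trans h.symm)

lemma continuous_sol {ρ ξ : ℝ} (hρ : 0 < ρ) {κ : ℝ → ℝ} (hκ : Continuous κ)
    (h0 : ∀ t, 0 ≤ κ t) (h1 : ∀ t, κ t ≤ 1) : Continuous fun t => sol ρ (κ t) ξ := by
  rw [continuous_iff_continuousAt]
  intro t₀
  have hm := strictMono_sub_psi hρ (h0 t₀) (h1 t₀)
  have hs := sol_spec hρ (h0 t₀) (h1 t₀) ξ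
  rw [ContinuousAt, tendsto_order]
  constructor
  · intro b hb
    have hlt := hm hb
    simp only [hs] at hlt
    have hc : ContinuousAt (fun t => b - κ t * psi ρ b) t₀ := by fun_prop
    filter_upwards [hc.eventually_lt continuousAt_const hlt] with t ht
    have hs' := sol_spec hρ (h0 t) (h1 t) ξ
    exact (strictMono_sub_psi hρ (h0 t) (h1 t)).lt_iff_lt.1 (by simpa only [hs'] using ht)
  · intro b hb
    have hlt := hm hb
    simp only [hs] at hlt
    have hc : ContinuousAt (fun t => b - κ t * psi ρ b) t₀ := by fun_prop
    filter_upwards [continuousAt_const.eventually_lt hc hlt] with t ht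
    have hs' := sol_spec hρ (h0 t) (h1 t) ξ
    exact (strictMono_sub_psi hρ (h0 t) (h1 t)).lt_iff_lt.1 (by simpa only [hs'] using ht)

/-- An odd cutoff in time, with values in `[-1, 1]` and `|η(t)| = 1` exactly for `|t| = 1/2`. -/
noncomputable def eta (t : ℝ) : ℝ := beta (16 * (t - 1 / 2) ^ 2) - beta (16 * (t + 1 / 2) ^ 2)

lemma contDiff_eta {m : ℕ∞} : ContDiff ℝ m eta :=
  (contDiff_beta.comp (contDiff_const.mul ((contDiff_id.sub contDiff_const).pow 2))).sub
    (contDiff_beta.comp (contDiff_const.mul ((contDiff_id.add contDiff_const).pow 2)))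

lemma continuous_eta : Continuous eta := (contDiff_eta (m := 0)).continuous

lemma eta_neg (t : ℝ) : eta (-t) = -eta t := by
  unfold eta
  rw [show 16 * (-t - 1 / 2) ^ 2 = 16 * (t + 1 / 2) ^ 2 by ring,
    show 16 * (-t + 1 / 2) ^ 2 = 16 * (t - 1 / 2) ^ 2 by ring]
  ring

lemma abs_eta_le (t : ℝ) : |eta t| ≤ 1 := by
  unfold eta
  rw [abs_le]
  constructor <;>
  linarith [beta_nonneg (16 * (t - 1 / 2) ^ 2), beta_nonneg (16 * (t + 1 / 2) ^ 2),
    beta_le_one (16 * (t - 1 / 2) ^ 2), beta_le_one (16 * (t + 1 / 2) ^ 2)]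

lemma eta_sq_le (t : ℝ) : eta t ^ 2 ≤ 1 := by
  rw [← sq_abs]; nlinarith [abs_eta_le t, abs_nonneg (eta t)]

lemma eta_eq_zero_of_le {t : ℝ} (h : 3 / 4 ≤ |t|) : eta t = 0 := by
  unfold eta
  rw [beta_eq_zero, beta_eq_zero, sub_zero]
  · rcases le_abs.1 h with h | h <;> nlinarith
  · rcases le_abs.1 h with h | h <;> nlinarith

lemma eta_eq_zero_of_ge {t : ℝ} (h : |t| ≤ 1 / 4) : eta t = 0 := by
  rw [abs_le] at h
  unfold eta
  rw [beta_eq_zero, beta_eq_zero, sub_zero] <;> nlinarith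

lemma abs_eq_half_of_eta_sq {t : ℝ} (h : eta t ^ 2 = 1) : |t| = 1 / 2 := by
  have b1 := beta_nonneg (16 * (t - 1 / 2) ^ 2)
  have b2 := beta_nonneg (16 * (t + 1 / 2) ^ 2)
  have b3 := beta_le_one (16 * (t - 1 / 2) ^ 2)
  have b4 := beta_le_one (16 * (t + 1 / 2) ^ 2)
  rcases sq_eq_one_iff.1 h with h | h
  · have : 16 * (t - 1 / 2) ^ 2 = 0 :=
      eq_zero_of_beta_eq_one (by positivity) (by unfold eta at h; linarith)
    have : t = 1 / 2 := by
      have : (t - 1 / 2) ^ 2 = 0 := by linarith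
      linarith [pow_eq_zero_iff (two_ne_zero) |>.1 this]
    rw [this, abs_of_pos]; norm_num
  · have : 16 * (t + 1 / 2) ^ 2 = 0 :=
      eq_zero_of_beta_eq_one (by positivity) (by unfold eta at h; linarith)
    have : t = -(1 / 2) := by
      have : (t + 1 / 2) ^ 2 = 0 := by linarith
      linarith [pow_eq_zero_iff (two_ne_zero) |>.1 this]
    rw [this, abs_neg, abs_of_pos]; norm_num

lemma eta_sq_of_abs_eq_half {t : ℝ} (h : |t| = 1 / 2) : eta t ^ 2 = 1 := by
  have h1 : beta 16 = 0 := beta_eq_zero (by norm_num)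
  have key : eta (1 / 2) = 1 := by
    unfold eta; norm_num [beta_zero, h1]
  rcases eq_or_eq_neg_of_abs_eq h with h | h
  · rw [h, key]; norm_num
  · rw [h, eta_neg, key]; norm_num

end HamiltonianSeifert

namespace HamiltonianSeifert

open Filter Topology Set
open scoped ContDiff

/-! ### Smoothness of complex coordinates over the reals -/

section Smooth

variable {X : Type*} [NormedAddCommGroup X] [NormedSpace ℝ X] {m : WithTop ℕ∞} {f : X → ℂ} {x : X}

@[fun_prop]
lemma contDiffAt_re (hf : ContDiffAt ℝ m f x) : ContDiffAt ℝ m (fun y => (f y).re) x :=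
  Complex.reCLM.contDiff.contDiffAt.comp x hf

@[fun_prop]
lemma contDiffAt_im (hf : ContDiffAt ℝ m f x) : ContDiffAt ℝ m (fun y => (f y).im) x :=
  Complex.imCLM.contDiff.contDiffAt.comp x hf

@[fun_prop]
lemma contDiffAt_ofReal {g : X → ℝ} (hg : ContDiffAt ℝ m g x) :
    ContDiffAt ℝ m (fun y => (g y : ℂ)) x :=
  Complex.ofRealCLM.contDiff.contDiffAt.comp x hg

@[fun_prop]
lemma contDiffAt_normSq (hf : ContDiffAt ℝ m f x) :
    ContDiffAt ℝ m (fun y => Complex.normSq (f y)) x := by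
  simp only [Complex.normSq_apply]
  fun_prop

lemma contDiffAt_arg (hf : ContDiffAt ℝ m f x) (h : f x ∈ Complex.slitPlane) :
    ContDiffAt ℝ m (fun y => (f y).arg) x := by
  simp only [← Complex.log_im]
  exact contDiffAt_im (((Complex.contDiffAt_log (n := m) h).restrict_scalars ℝ).comp x hf)

end Smooth

/-! ### The model ellipsoid -/

variable {n : ℕ}

/-- The frequencies of the model ellipsoid. -/
noncomputable def freq (k : Fin n) : ℝ := 1 / (√2 + (k : ℕ))

lemma sqrt_two_bounds : (7 / 5 : ℝ) < √2 ∧ √2 < 17 / 12 := by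
  constructor
  · rw [Real.lt_sqrt] <;> norm_num
  · rw [Real.sqrt_lt'] <;> norm_num

lemma freq_pos (k : Fin n) : 0 < freq k := by
  have := sqrt_two_bounds.1
  unfold freq
  positivity

lemma freq_le (k : Fin n) : freq k ≤ 5 / 7 := by
  have h := sqrt_two_bounds.1
  have h2 : (0 : ℝ) ≤ (k : ℕ) := by positivity
  unfold freq
  rw [div_le_iff₀ (by linarith)]
  linarith

/-- The energy of the model ellipsoid, normalized so that the ellipsoid is its zero level. -/
noncomputable def energy (z : EuclideanSpace ℂ (Fin n)) : ℝ :=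
  ∑ k, freq k * Complex.normSq (z k) / 2 - 10 * n

lemma contDiff_energy {m : WithTop ℕ∞} : ContDiff ℝ m (energy (n := n)) := by
  rw [contDiff_iff_contDiffAt]
  intro x
  unfold energy
  fun_prop

/-! ### Flow-box coordinates -/

/-- The time coordinate of the flow box with axis `j`. -/
noncomputable def flowTime (j : Fin n) (z : EuclideanSpace ℂ (Fin n)) : ℝ := (z j).arg / freq j

/-- The transverse coordinates of the flow box with axis `j`. -/
noncomputable def trans (j : Fin n) (z : EuclideanSpace ℂ (Fin n)) (k : Fin n) : ℂ :=
  Complex.exp (-(freq k * flowTime j z : ℝ) * Complex.I) * z k + 1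

/-- The action variables attached to transverse coordinates. -/
noncomputable def action (u : Fin n → ℂ) (k : Fin n) : ℝ := (Complex.normSq (u k) - 1) / 2

/-- The squared radius of the axis coordinate, up to a factor. -/
noncomputable def axisSq (j : Fin n) (h : ℝ) (u : Fin n → ℂ) : ℝ :=
  10 * n + h - ∑ k ∈ Finset.univ.erase j, freq k * Complex.normSq (u k - 1) / 2

/-- The inverse of the flow-box coordinates with axis `j`. -/
noncomputable def chart (j : Fin n) (t h : ℝ) (u : Fin n → ℂ) : EuclideanSpace ℂ (Fin n) :=
  WithLp.toLp 2 fun k =>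
    Complex.exp ((freq k * t : ℝ) * Complex.I) *
      if k = j then (√(2 / freq j * axisSq j h u) : ℂ) else u k - 1

lemma chart_axis (j : Fin n) (t h : ℝ) (u : Fin n → ℂ) : chart j t h u j =
    Complex.exp ((freq j * t : ℝ) * Complex.I) * (√(2 / freq j * axisSq j h u) : ℂ) := by
  simp [chart]

lemma chart_of_ne {j k : Fin n} (hk : k ≠ j) (t h : ℝ) (u : Fin n → ℂ) : chart j t h u k =
    Complex.exp ((freq k * t : ℝ) * Complex.I) * (u k - 1) := by
  simp [chart, hk]

lemma normSq_exp_mul_I (x : ℝ) (w : ℂ) :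
    Complex.normSq (Complex.exp ((x : ℝ) * Complex.I) * w) = Complex.normSq w := by
  rw [Complex.normSq_mul, Complex.normSq_eq_norm_sq, Complex.norm_exp_ofReal_mul_I]
  simp

lemma axisSq_congr {j : Fin n} {h : ℝ} {u u' : Fin n → ℂ} (hu : ∀ k ≠ j, u k = u' k) :
    axisSq j h u = axisSq j h u' := by
  unfold axisSq
  congr 1
  exact Finset.sum_congr rfl fun k hk => by rw [hu k (Finset.ne_of_mem_erase hk)]

lemma chart_congr {j : Fin n} {t h : ℝ} {u u' : Fin n → ℂ} (hu : ∀ k ≠ j, u k = u' k) :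
    chart j t h u = chart j t h u' := by
  ext k
  by_cases hk : k = j
  · subst hk; rw [chart_axis, chart_axis, axisSq_congr hu]
  · rw [chart_of_ne hk, chart_of_ne hk, hu k hk]

lemma energy_eq (j : Fin n) (z : EuclideanSpace ℂ (Fin n)) : energy z =
    freq j * Complex.normSq (z j) / 2 +
      ∑ k ∈ Finset.univ.erase j, freq k * Complex.normSq (z k) / 2 - 10 * n := by
  rw [energy, ← Finset.add_sum_erase _ _ (Finset.mem_univ j)]

lemma energy_chart {j : Fin n} {t h : ℝ} {u : Fin n → ℂ} (hp : 0 ≤ axisSq j h u) :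
    energy (chart j t h u) = h := by
  have ha := freq_pos j
  rw [energy_eq j, chart_axis, normSq_exp_mul_I, Complex.normSq_ofReal,
    Real.mul_self_sqrt (by positivity), Finset.sum_congr rfl fun k hk => by
      rw [chart_of_ne (Finset.ne_of_mem_erase hk), normSq_exp_mul_I]]
  rw [axisSq]
  field_simp
  ring

lemma flowTime_chart {j : Fin n} {t h : ℝ} {u : Fin n → ℂ} (hp : 0 < axisSq j h u)
    (ht : |freq j * t| < Real.pi / 2) : flowTime j (chart j t h u) = t := by
  have ha := freq_pos j
  have hr : 0 < √(2 / freq j * axisSq j h u) := Real.sqrt_pos.2 (by positivity)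
  rw [flowTime, chart_axis, mul_comm, Complex.exp_mul_I, Complex.arg_mul_cos_add_sin_mul_I hr]
  · field_simp
  · rw [abs_lt] at ht
    constructor <;> linarith [Real.pi_pos]

lemma trans_chart {j k : Fin n} {t h : ℝ} {u : Fin n → ℂ} (hp : 0 < axisSq j h u)
    (ht : |freq j * t| < Real.pi / 2) (hk : k ≠ j) : trans j (chart j t h u) k = u k := by
  rw [trans, flowTime_chart hp ht, chart_of_ne hk, ← mul_assoc, ← Complex.exp_add,
    ← add_mul, neg_add_cancel]
  simp

lemma abs_freq_mul_flowTime_lt {j : Fin n} {z : EuclideanSpace ℂ (Fin n)} (hz : 0 < (z j).re) :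
    |freq j * flowTime j z| < Real.pi / 2 := by
  rw [flowTime, mul_div_cancel₀ _ (freq_pos j).ne']
  exact Complex.abs_arg_lt_pi_div_two_iff.2 (Or.inl hz)

lemma normSq_trans_sub_one (j k : Fin n) (z : EuclideanSpace ℂ (Fin n)) :
    Complex.normSq (trans j z k - 1) = Complex.normSq (z k) := by
  rw [trans, add_sub_cancel_right, ← Complex.ofReal_neg, normSq_exp_mul_I]

lemma axisSq_trans (j : Fin n) (z : EuclideanSpace ℂ (Fin n)) :
    axisSq j (energy z) (trans j z) = freq j * Complex.normSq (z j) / 2 := by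
  rw [axisSq, energy_eq j]
  simp only [normSq_trans_sub_one]
  ring

lemma chart_trans (j : Fin n) (z : EuclideanSpace ℂ (Fin n)) :
    chart j (flowTime j z) (energy z) (trans j z) = z := by
  have ha := freq_pos j
  ext k
  by_cases hk : k = j
  · subst hk
    rw [chart_axis, axisSq_trans]
    have : 2 / freq k * (freq k * Complex.normSq (z k) / 2) = ‖z k‖ ^ 2 := by
      rw [Complex.normSq_eq_norm_sq]; field_simp
    rw [this, Real.sqrt_sq (norm_nonneg _), mul_comm, flowTime, mul_div_cancel₀ _ ha.ne']
    exact Complex.norm_mul_exp_arg_mul_I _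
  · rw [chart_of_ne hk, trans, add_sub_cancel_right, ← mul_assoc, ← Complex.exp_add,
      ← add_mul, add_neg_cancel]
    simp

lemma re_chart_pos {j : Fin n} {t h : ℝ} {u : Fin n → ℂ} (hp : 0 < axisSq j h u)
    (ht : |freq j * t| < Real.pi / 2) : 0 < (chart j t h u j).re := by
  have ha := freq_pos j
  have hr : 0 < √(2 / freq j * axisSq j h u) := Real.sqrt_pos.2 (by positivity)
  rw [chart_axis, Complex.re_mul_ofReal, Complex.exp_ofReal_mul_I_re]
  exact mul_pos (Real.cos_pos_of_mem_Ioo (abs_lt.1 ht)) hr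

section Smooth

variable {X : Type*} [NormedAddCommGroup X] [NormedSpace ℝ X] {m : WithTop ℕ∞} {x : X}

lemma contDiffAt_flowTime {j : Fin n} {z : EuclideanSpace ℂ (Fin n)} (hz : 0 < (z j).re) :
    ContDiffAt ℝ m (flowTime j) z := by
  unfold flowTime
  exact (contDiffAt_arg (f := fun w : EuclideanSpace ℂ (Fin n) => w j) (by fun_prop)
    (Or.inl hz)).div_const _

lemma contDiffAt_trans {j k : Fin n} {z : EuclideanSpace ℂ (Fin n)} (hz : 0 < (z j).re) :
    ContDiffAt ℝ m (fun w => trans j w k) z := by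
  unfold trans
  have := contDiffAt_flowTime (m := m) hz
  fun_prop

lemma contDiffAt_axisSq {j : Fin n} {h : X → ℝ} {u : X → Fin n → ℂ}
    (hh : ContDiffAt ℝ m h x) (hu : ∀ k ≠ j, ContDiffAt ℝ m (fun y => u y k) x) :
    ContDiffAt ℝ m (fun y => axisSq j (h y) (u y)) x := by
  unfold axisSq
  refine (contDiffAt_const.add hh).sub (ContDiffAt.sum fun k hk => ?_)
  have := hu k (Finset.ne_of_mem_erase hk)
  fun_prop

lemma contDiffAt_chart {j : Fin n} {t h : X → ℝ} {u : X → Fin n → ℂ}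
    (ht : ContDiffAt ℝ m t x) (hh : ContDiffAt ℝ m h x)
    (hu : ∀ k ≠ j, ContDiffAt ℝ m (fun y => u y k) x) (hp : 0 < axisSq j (h x) (u x)) :
    ContDiffAt ℝ m (fun y => chart j (t y) (h y) (u y)) x := by
  have ha := freq_pos j
  refine contDiffAt_piLp' _ fun k => ?_
  by_cases hk : k = j
  · subst hk
    simp only [chart_axis]
    have h1 := contDiffAt_axisSq hh hu
    have h2 : ContDiffAt ℝ m (fun y => √(2 / freq k * axisSq k (h y) (u y))) x :=
      (contDiffAt_const.mul h1).sqrt (by positivity)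
    fun_prop
  · simp only [chart_of_ne hk]
    have := hu k hk
    fun_prop

end Smooth

/-! ### The domain of a plug -/

/-- The domain of the plug with axis `j`. -/
def dom (j : Fin n) : Set (EuclideanSpace ℂ (Fin n)) :=
  {z | 0 < (z j).re ∧ ∀ k ≠ j, |action (trans j z) k| < 3 / 8}

lemma contDiffAt_action {j k : Fin n} {m : WithTop ℕ∞} {z : EuclideanSpace ℂ (Fin n)}
    (hz : 0 < (z j).re) : ContDiffAt ℝ m (fun w => action (trans j w) k) z := by
  have := contDiffAt_trans (m := m) (k := k) hz
  unfold action
  fun_prop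

lemma continuousAt_action {j k : Fin n} {z : EuclideanSpace ℂ (Fin n)} (hz : 0 < (z j).re) :
    ContinuousAt (fun w => action (trans j w) k) z :=
  (contDiffAt_action (m := 0) hz).continuousAt

lemma isOpen_dom (j : Fin n) : IsOpen (dom j) := by
  rw [isOpen_iff_mem_nhds]
  rintro z ⟨h1, h2⟩
  have c1 : ContinuousAt (fun w : EuclideanSpace ℂ (Fin n) => (w j).re) z := by fun_prop
  filter_upwards [continuousAt_const.eventually_lt c1 h1,
    eventually_all.2 fun k => eventually_imp_distrib_left.2 fun hk : k ≠ j =>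
      (continuousAt_action (k := k) h1).abs.eventually_lt continuousAt_const (h2 k hk)] with w hw hw'
  exact ⟨hw, hw'⟩

lemma normSq_lt_of_action_lt {u : Fin n → ℂ} {k : Fin n} (h : |action u k| < 3 / 8) :
    1 / 4 < Complex.normSq (u k) ∧ Complex.normSq (u k) < 7 / 4 := by
  rw [action, abs_lt] at h
  constructor <;> linarith

lemma normSq_sub_one_lt {u : Fin n → ℂ} {k : Fin n} (h : |action u k| < 3 / 8) :
    Complex.normSq (u k - 1) < 6 := by
  have h1 := (normSq_lt_of_action_lt h).2
  rw [Complex.normSq_apply] at h1 ⊢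
  simp only [Complex.sub_re, Complex.one_re, Complex.sub_im, Complex.one_im]
  nlinarith [sq_nonneg ((u k).re + 7 / 5), sq_nonneg (u k).im]

lemma axisSq_gt {j : Fin n} {h : ℝ} {u : Fin n → ℂ} (hh : -1 ≤ h)
    (hu : ∀ k ≠ j, |action u k| < 3 / 8) : 13 / 2 * n ≤ axisSq j h u := by
  have hn : (1 : ℝ) ≤ n := by exact_mod_cast j.pos
  have key : ∑ k ∈ Finset.univ.erase j, freq k * Complex.normSq (u k - 1) / 2
      ≤ (Finset.univ.erase j).card • (15 / 7 : ℝ) := by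
    refine Finset.sum_le_card_nsmul _ _ _ fun k hk => ?_
    have h1 := normSq_sub_one_lt (hu k (Finset.ne_of_mem_erase hk))
    have h2 := freq_le k
    have h3 := freq_pos k
    nlinarith [Complex.normSq_nonneg (u k - 1)]
  have hc : ((Finset.univ.erase j).card : ℝ) ≤ n := by
    exact_mod_cast (Finset.card_erase_le).trans (by simp)
  rw [nsmul_eq_mul] at key
  rw [axisSq]
  linarith

lemma axisSq_pos {j : Fin n} {h : ℝ} {u : Fin n → ℂ} (hh : -1 ≤ h)
    (hu : ∀ k ≠ j, |action u k| < 3 / 8) : 0 < axisSq j h u := by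
  have hn : (1 : ℝ) ≤ n := by exact_mod_cast j.pos
  have := axisSq_gt hh hu
  linarith

lemma normSq_axis_gt {j : Fin n} {z : EuclideanSpace ℂ (Fin n)} (hz : z ∈ dom j)
    (hh : -1 ≤ energy z) (hn : 3 ≤ n) : 36 < Complex.normSq (z j) := by
  have hn' : (3 : ℝ) ≤ n := by exact_mod_cast hn
  have h1 := axisSq_gt hh hz.2
  rw [axisSq_trans] at h1
  nlinarith [freq_le j, freq_pos j, Complex.normSq_nonneg (z j)]

lemma eq_of_mem_dom {j l : Fin n} {z : EuclideanSpace ℂ (Fin n)} (hn : 3 ≤ n)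
    (hh : -1 ≤ energy z) (hj : z ∈ dom j) (hl : z ∈ dom l) : j = l := by
  by_contra hne
  have h1 := normSq_axis_gt hj hh hn
  have h2 := normSq_sub_one_lt (hl.2 j hne)
  rw [normSq_trans_sub_one] at h2
  linarith

/-- Near a point outside the domain of a plug, points of the domain are near its boundary. -/
lemma eventually_of_not_mem_dom {j : Fin n} {z₀ : EuclideanSpace ℂ (Fin n)} (hn : 3 ≤ n)
    (hz₀ : z₀ ∉ dom j) : ∀ᶠ z in 𝓝 z₀, -1 ≤ energy z → z ∈ dom j →
      3 / 4 ≤ |flowTime j z| ∨ ∃ k ≠ j, 1 / 4 < |action (trans j z) k| := by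
  by_cases h1 : (z₀ j).re < 1
  · have c1 : ContinuousAt (fun w : EuclideanSpace ℂ (Fin n) => (w j).re) z₀ := by fun_prop
    filter_upwards [c1.eventually_lt continuousAt_const h1] with z hz hh hd
    left
    have h2 := normSq_axis_gt hd hh hn
    have h3 : 6 < ‖z j‖ := by
      rw [Complex.normSq_eq_norm_sq] at h2
      nlinarith [norm_nonneg (z j)]
    have h4 : Real.cos (z j).arg * ‖z j‖ = (z j).re := by
      rw [mul_comm, Complex.norm_mul_cos_arg]
    have h5 : Real.cos (z j).arg < 1 / 6 := by
      by_contra hc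
      nlinarith
    have h6 := Real.one_sub_sq_div_two_le_cos (x := (z j).arg)
    have h7 : 1 < |(z j).arg| := by
      by_contra hc
      have := sq_abs (z j).arg
      nlinarith [abs_nonneg (z j).arg]
    rw [flowTime, abs_div, abs_of_pos (freq_pos j), le_div_iff₀ (freq_pos j)]
    linarith [freq_le j]
  · have h0 : 0 < (z₀ j).re := by linarith
    have : ∃ k ≠ j, 3 / 8 ≤ |action (trans j z₀) k| := by
      by_contra! hc
      exact hz₀ ⟨h0, hc⟩
    obtain ⟨k, hk, hk'⟩ := this
    filter_upwards [continuousAt_const.eventually_lt (continuousAt_action (k := k) h0).abs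
      (show 1 / 4 < |action (trans j z₀) k| by linarith)] with z hz _ _
    exact Or.inr ⟨k, hk, hz⟩

end HamiltonianSeifert

namespace HamiltonianSeifert

open Filter Topology Set
open scoped ContDiff

/-! ### The profile of a plug -/

variable {n : ℕ} {j k₁ : Fin n}

/-- The size of the support of the plugs. -/
noncomputable def rad (n : ℕ) : ℝ := 1 / (16 * n)

lemma rad_pos (j : Fin n) : 0 < rad n := by
  have : (0 : ℝ) < n := by exact_mod_cast j.pos
  unfold rad
  positivity

lemma rad_le (hn : 3 ≤ n) : rad n ≤ 1 / 48 := by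
  have : (3 : ℝ) ≤ n := by exact_mod_cast hn
  unfold rad
  apply one_div_le_one_div_of_le <;> linarith

/-- The weights of the linear flow trapped inside a plug. -/
noncomputable def wt (k₁ k : Fin n) : ℝ := if k = k₁ then 1 else √2

/-- The linear combination of the actions which generates the trapped flow. -/
noncomputable def lin (j k₁ : Fin n) (d : Fin n → ℝ) : ℝ :=
  ∑ k ∈ Finset.univ.erase j, wt k₁ k * d k

/-- The sum of squares of the actions other than the one of index `k₁`. -/
noncomputable def sqSum (j k₁ : Fin n) (d : Fin n → ℝ) : ℝ :=
  ∑ k ∈ (Finset.univ.erase j).erase k₁, d k ^ 2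

/-- A cutoff in the actions other than the one of index `k₁`. -/
noncomputable def bump (j k₁ : Fin n) (d : Fin n → ℝ) : ℝ := beta (sqSum j k₁ d / rad n ^ 2)

lemma sqSum_nonneg (d : Fin n → ℝ) : 0 ≤ sqSum j k₁ d :=
  Finset.sum_nonneg fun _ _ => sq_nonneg _

lemma bump_nonneg (d : Fin n → ℝ) : 0 ≤ bump j k₁ d := beta_nonneg _

lemma bump_le_one (d : Fin n → ℝ) : bump j k₁ d ≤ 1 := beta_le_one _

lemma lin_eq (h1 : k₁ ≠ j) (d : Fin n → ℝ) :
    lin j k₁ d = d k₁ + √2 * ∑ k ∈ (Finset.univ.erase j).erase k₁, d k := by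
  rw [lin, ← Finset.add_sum_erase _ _ (Finset.mem_erase.2 ⟨h1, Finset.mem_univ k₁⟩),
    Finset.mul_sum]
  congr 1
  · simp [wt]
  · exact Finset.sum_congr rfl fun k hk => by simp [wt, Finset.ne_of_mem_erase hk]

/-- Away from the origin in the space of actions, the profile is trivial. -/
lemma off_support (hn : 3 ≤ n) (h1 : k₁ ≠ j) {d : Fin n → ℝ} (hd : ∃ k ≠ j, 1 / 4 < |d k|) :
    1 ≤ sqSum j k₁ d / rad n ^ 2 ∨ 2 * rad n ≤ |lin j k₁ d| := by
  have hρ := rad_pos j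
  have hρ' := rad_le hn
  by_cases hO : ∃ k ∈ (Finset.univ.erase j).erase k₁, rad n ≤ |d k|
  · left
    obtain ⟨k, hk, hk'⟩ := hO
    rw [le_div_iff₀ (by positivity), one_mul]
    calc rad n ^ 2 ≤ |d k| ^ 2 := by gcongr
      _ = d k ^ 2 := sq_abs _
      _ ≤ _ := Finset.single_le_sum (f := fun k => d k ^ 2) (fun _ _ => sq_nonneg _) hk
  · right
    push Not at hO
    obtain ⟨k, hk, hk'⟩ := hd
    have hkk : k = k₁ := by
      by_contra hne
      have := hO k (by simp [hk, hne])
      linarith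
    subst hkk
    have hS : |∑ l ∈ (Finset.univ.erase j).erase k, d l| ≤ 1 / 16 := by
      refine (Finset.abs_sum_le_sum_abs _ _).trans ?_
      refine (Finset.sum_le_card_nsmul _ _ _ fun l hl => (hO l hl).le).trans ?_
      have hc : ((((Finset.univ.erase j).erase k).card : ℕ) : ℝ) ≤ n := by
        exact_mod_cast (Finset.card_erase_le).trans ((Finset.card_erase_le).trans (by simp))
      have hn' : (0 : ℝ) < n := by exact_mod_cast j.pos
      rw [nsmul_eq_mul]
      calc _ ≤ n * rad n := by gcongr
        _ = _ := by unfold rad; field_simp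
    rw [lin_eq h1]
    have h2 : |√2 * ∑ l ∈ (Finset.univ.erase j).erase k, d l| ≤ 17 / 12 * (1 / 16) := by
      rw [abs_mul, abs_of_nonneg (Real.sqrt_nonneg 2)]
      have := sqrt_two_bounds.2.le
      gcongr
    have h3 := abs_sub_abs_le_abs_sub (d k) (-(√2 * ∑ l ∈ (Finset.univ.erase j).erase k, d l))
    rw [sub_neg_eq_add, abs_neg] at h3
    linarith

/-- The profile of a plug. -/
noncomputable def prof (j k₁ : Fin n) (e y : ℝ) (d : Fin n → ℝ) : ℝ :=
  e * bump j k₁ d * psi (rad n) y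

lemma abs_prof_le {e : ℝ} (he : |e| ≤ 1) (y : ℝ) (d : Fin n → ℝ) :
    |prof j k₁ e y d| ≤ rad n := by
  rw [prof, abs_mul, abs_mul, abs_of_nonneg (bump_nonneg d)]
  calc _ ≤ 1 * 1 * rad n := by
        have := bump_nonneg (j := j) (k₁ := k₁) d
        have := bump_le_one (j := j) (k₁ := k₁) d
        have := abs_psi_le (rad_pos j) y
        gcongr
    _ = _ := by ring

lemma prof_eq_zero (hn : 3 ≤ n) (h1 : k₁ ≠ j) {d : Fin n → ℝ}
    (hd : ∃ k ≠ j, 1 / 4 < |d k|) (e : ℝ) : prof j k₁ e (lin j k₁ d) d = 0 := by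
  have hρ := rad_pos j
  rcases off_support hn h1 hd with h | h
  · simp [prof, bump, beta_eq_zero h]
  · simp [prof, psi_eq_zero hρ (show rad n ≤ |lin j k₁ d| by linarith)]

/-! ### Radial shifts of one action -/

/-- Scale the coordinate of index `k₁` so that its action is shifted by `δ`. -/
noncomputable def shift (k₁ : Fin n) (u : Fin n → ℂ) (δ : ℝ) : Fin n → ℂ :=
  Function.update u k₁ (u k₁ * (√(1 + 2 * δ / Complex.normSq (u k₁)) : ℂ))

lemma shift_of_ne {k : Fin n} (hk : k ≠ k₁) (u : Fin n → ℂ) (δ : ℝ) : shift k₁ u δ k = u k := by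
  simp [shift, hk]

lemma shift_self (u : Fin n → ℂ) (δ : ℝ) :
    shift k₁ u δ k₁ = u k₁ * (√(1 + 2 * δ / Complex.normSq (u k₁)) : ℂ) := by
  simp [shift]

lemma shift_zero (u : Fin n → ℂ) : shift k₁ u 0 = u := by
  simp [shift]

lemma normSq_shift {u : Fin n → ℂ} {δ : ℝ} (h0 : 0 < Complex.normSq (u k₁))
    (hδ : 0 < Complex.normSq (u k₁) + 2 * δ) :
    Complex.normSq (shift k₁ u δ k₁) = Complex.normSq (u k₁) + 2 * δ := by
  have : 1 + 2 * δ / Complex.normSq (u k₁) =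
      (Complex.normSq (u k₁) + 2 * δ) / Complex.normSq (u k₁) := by field_simp
  rw [shift_self, Complex.normSq_mul, Complex.normSq_ofReal, Real.mul_self_sqrt, this,
    mul_div_cancel₀ _ h0.ne']
  rw [this]
  positivity

lemma action_shift {u : Fin n → ℂ} {δ : ℝ} (h0 : 0 < Complex.normSq (u k₁))
    (hδ : 0 < Complex.normSq (u k₁) + 2 * δ) :
    action (shift k₁ u δ) = Function.update (action u) k₁ (action u k₁ + δ) := by
  ext k
  by_cases hk : k = k₁
  · subst hk
    rw [action, normSq_shift h0 hδ, Function.update_self, action]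
    ring
  · rw [action, shift_of_ne hk, Function.update_of_ne hk, action]

lemma shift_shift {u : Fin n → ℂ} {δ : ℝ} (h0 : 0 < Complex.normSq (u k₁))
    (hδ : 0 < Complex.normSq (u k₁) + 2 * δ) : shift k₁ (shift k₁ u δ) (-δ) = u := by
  have e1 : 1 + 2 * δ / Complex.normSq (u k₁) =
      (Complex.normSq (u k₁) + 2 * δ) / Complex.normSq (u k₁) := by field_simp
  have e2 : 1 + 2 * (-δ) / (Complex.normSq (u k₁) + 2 * δ) =
      Complex.normSq (u k₁) / (Complex.normSq (u k₁) + 2 * δ) := by field_simp; ring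
  ext k
  by_cases hk : k = k₁
  · subst hk
    rw [shift_self, normSq_shift h0 hδ, shift_self, mul_assoc, ← Complex.ofReal_mul, e1, e2,
      ← Real.sqrt_mul (by positivity), div_mul_div_cancel₀ (by positivity), div_self hδ.ne']
    simp
  · rw [shift_of_ne hk, shift_of_ne hk]

/-! ### Plugs -/

/-- Set the energy to `h` and shift the action of index `k₁` by `δ`. -/
noncomputable def push (j k₁ : Fin n) (z : EuclideanSpace ℂ (Fin n)) (h δ : ℝ) :
    EuclideanSpace ℂ (Fin n) :=
  chart j (flowTime j z) h (shift k₁ (trans j z) δ)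

/-- The energy added by a plug. -/
noncomputable def gain (j k₁ : Fin n) (z : EuclideanSpace ℂ (Fin n)) : ℝ :=
  prof j k₁ (eta (flowTime j z)) (lin j k₁ (action (trans j z))) (action (trans j z))

/-- The plug with axis `j`. -/
noncomputable def plug (j k₁ : Fin n) (z : EuclideanSpace ℂ (Fin n)) :
    EuclideanSpace ℂ (Fin n) :=
  push j k₁ z (gain j k₁ z) (-(eta (flowTime j z) * gain j k₁ z))

/-- The inverse of the plug with axis `j`. -/
noncomputable def unplug (j k₁ : Fin n) (q : EuclideanSpace ℂ (Fin n)) :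
    EuclideanSpace ℂ (Fin n) :=
  push j k₁ q 0 (eta (flowTime j q) * energy q)

/-- A defining function for the deformed ellipsoid inside the plug with axis `j`. -/
noncomputable def level (j k₁ : Fin n) (q : EuclideanSpace ℂ (Fin n)) : ℝ :=
  energy q - prof j k₁ (eta (flowTime j q))
    (lin j k₁ (action (trans j q)) + eta (flowTime j q) * energy q) (action (trans j q))

lemma abs_gain_le (z : EuclideanSpace ℂ (Fin n)) : |gain j k₁ z| ≤ rad n :=
  abs_prof_le (abs_eta_le _) _ _

lemma abs_eta_mul_le {e x r : ℝ} (he : |e| ≤ 1) (hx : |x| ≤ r) : |e * x| ≤ r := by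
  rw [abs_mul]
  exact (mul_le_of_le_one_left (abs_nonneg _) he).trans hx

lemma gain_eq_zero (hn : 3 ≤ n) (h1 : k₁ ≠ j) {z : EuclideanSpace ℂ (Fin n)}
    (hz : 3 / 4 ≤ |flowTime j z| ∨ ∃ k ≠ j, 1 / 4 < |action (trans j z) k|) :
    gain j k₁ z = 0 := by
  rcases hz with h | h
  · simp [gain, prof, eta_eq_zero_of_le h]
  · exact prof_eq_zero hn h1 h _

lemma push_self (z : EuclideanSpace ℂ (Fin n)) : push j k₁ z (energy z) 0 = z := by
  rw [push, shift_zero, chart_trans]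

lemma plug_eq_self {z : EuclideanSpace ℂ (Fin n)} (he : energy z = 0) (hg : gain j k₁ z = 0) :
    plug j k₁ z = z := by
  rw [plug, hg, mul_zero, neg_zero]
  simpa [he] using push_self (j := j) (k₁ := k₁) z

section

variable {z : EuclideanSpace ℂ (Fin n)}

lemma normSq_add_pos (hn : 3 ≤ n) (h1 : k₁ ≠ j) (hz : z ∈ dom j) {δ : ℝ} (hδ : |δ| ≤ rad n) :
    0 < Complex.normSq (trans j z k₁) + 2 * δ := by
  have h2 := (normSq_lt_of_action_lt (hz.2 k₁ h1)).1
  have h3 := rad_le hn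
  linarith [(abs_le.1 hδ).1]

lemma normSq_trans_pos (h1 : k₁ ≠ j) (hz : z ∈ dom j) : 0 < Complex.normSq (trans j z k₁) := by
  linarith [(normSq_lt_of_action_lt (hz.2 k₁ h1)).1]

lemma abs_shift_plug_le : |-(eta (flowTime j z) * gain j k₁ z)| ≤ rad n := by
  rw [abs_neg]
  exact abs_eta_mul_le (abs_eta_le _) (abs_gain_le z)

lemma action_shift_plug (hn : 3 ≤ n) (h1 : k₁ ≠ j) (hz : z ∈ dom j) :
    action (shift k₁ (trans j z) (-(eta (flowTime j z) * gain j k₁ z))) =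
      Function.update (action (trans j z)) k₁
        (action (trans j z) k₁ - eta (flowTime j z) * gain j k₁ z) := by
  rw [action_shift (normSq_trans_pos h1 hz) (normSq_add_pos hn h1 hz abs_shift_plug_le),
    sub_eq_add_neg]

lemma abs_action_shift_plug_lt (hn : 3 ≤ n) (h1 : k₁ ≠ j) (hz : z ∈ dom j) :
    ∀ k ≠ j, |action (shift k₁ (trans j z) (-(eta (flowTime j z) * gain j k₁ z))) k| < 3 / 8 := by
  intro k hk
  rw [action_shift_plug hn h1 hz]
  by_cases hkk : k = k₁
  · subst hkk
    rw [Function.update_self]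
    by_cases hg : gain j k z = 0
    · rw [hg, mul_zero, sub_zero]
      exact hz.2 k hk
    · have h2 : ¬ 1 / 4 < |action (trans j z) k| := fun h =>
        hg (gain_eq_zero hn h1 (Or.inr ⟨k, hk, h⟩))
      have h3 := abs_shift_plug_le (j := j) (k₁ := k) (z := z)
      rw [abs_neg] at h3
      have h4 := abs_sub (action (trans j z) k) (eta (flowTime j z) * gain j k z)
      have h5 := rad_le hn
      linarith
  · rw [Function.update_of_ne hkk]
    exact hz.2 k hk

lemma axisSq_plug_pos (hn : 3 ≤ n) (h1 : k₁ ≠ j) (hz : z ∈ dom j) :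
    0 < axisSq j (gain j k₁ z)
      (shift k₁ (trans j z) (-(eta (flowTime j z) * gain j k₁ z))) := by
  refine axisSq_pos ?_ (abs_action_shift_plug_lt hn h1 hz)
  linarith [(abs_le.1 (abs_gain_le (j := j) (k₁ := k₁) z)).1, rad_le hn]

lemma flowTime_plug (hn : 3 ≤ n) (h1 : k₁ ≠ j) (hz : z ∈ dom j) :
    flowTime j (plug j k₁ z) = flowTime j z :=
  flowTime_chart (axisSq_plug_pos hn h1 hz) (abs_freq_mul_flowTime_lt hz.1)

lemma energy_plug (hn : 3 ≤ n) (h1 : k₁ ≠ j) (hz : z ∈ dom j) :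
    energy (plug j k₁ z) = gain j k₁ z :=
  energy_chart (axisSq_plug_pos hn h1 hz).le

lemma trans_plug (hn : 3 ≤ n) (h1 : k₁ ≠ j) (hz : z ∈ dom j) {k : Fin n} (hk : k ≠ j) :
    trans j (plug j k₁ z) k =
      shift k₁ (trans j z) (-(eta (flowTime j z) * gain j k₁ z)) k :=
  trans_chart (axisSq_plug_pos hn h1 hz) (abs_freq_mul_flowTime_lt hz.1) hk

lemma action_plug (hn : 3 ≤ n) (h1 : k₁ ≠ j) (hz : z ∈ dom j) {k : Fin n} (hk : k ≠ j) :
    action (trans j (plug j k₁ z)) k = Function.update (action (trans j z)) k₁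
        (action (trans j z) k₁ - eta (flowTime j z) * gain j k₁ z) k := by
  rw [← action_shift_plug hn h1 hz, action, trans_plug hn h1 hz hk, action]

lemma plug_mem_dom (hn : 3 ≤ n) (h1 : k₁ ≠ j) (hz : z ∈ dom j) : plug j k₁ z ∈ dom j := by
  refine ⟨re_chart_pos (axisSq_plug_pos hn h1 hz) (abs_freq_mul_flowTime_lt hz.1), ?_⟩
  intro k hk
  rw [action_plug hn h1 hz hk, ← action_shift_plug hn h1 hz]
  exact abs_action_shift_plug_lt hn h1 hz k hk

lemma shift_trans_plug (hn : 3 ≤ n) (h1 : k₁ ≠ j) (hz : z ∈ dom j) {k : Fin n} (hk : k ≠ j) :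
    shift k₁ (trans j (plug j k₁ z)) (eta (flowTime j z) * gain j k₁ z) k = trans j z k := by
  have h2 := shift_shift (normSq_trans_pos h1 hz) (normSq_add_pos hn h1 hz
    (abs_shift_plug_le (j := j) (k₁ := k₁) (z := z)))
  rw [neg_neg] at h2
  by_cases hkk : k = k₁
  · subst hkk
    rw [shift_self, trans_plug hn h1 hz h1, ← shift_self, h2]
  · rw [shift_of_ne hkk, trans_plug hn h1 hz hk, shift_of_ne hkk]

lemma unplug_plug (hn : 3 ≤ n) (h1 : k₁ ≠ j) (hz : z ∈ dom j) (he : energy z = 0) :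
    unplug j k₁ (plug j k₁ z) = z := by
  rw [unplug, push, flowTime_plug hn h1 hz, energy_plug hn h1 hz]
  conv_rhs => rw [← chart_trans j z, he]
  refine chart_congr fun k hk => ?_
  exact shift_trans_plug hn h1 hz hk

lemma lin_congr {d d' : Fin n → ℝ} (h : ∀ k ≠ j, d k = d' k) : lin j k₁ d = lin j k₁ d' :=
  Finset.sum_congr rfl fun k hk => by rw [h k (Finset.ne_of_mem_erase hk)]

lemma bump_congr {d d' : Fin n → ℝ} (h : ∀ k ≠ j, k ≠ k₁ → d k = d' k) :
    bump j k₁ d = bump j k₁ d' := by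
  unfold bump sqSum
  congr 2
  refine Finset.sum_congr rfl fun k hk => ?_
  rw [Finset.mem_erase, Finset.mem_erase] at hk
  rw [h k hk.2.1 hk.1]

lemma lin_update (h1 : k₁ ≠ j) (d : Fin n → ℝ) (x : ℝ) :
    lin j k₁ (Function.update d k₁ (d k₁ - x)) = lin j k₁ d - x := by
  have : ∑ k ∈ (Finset.univ.erase j).erase k₁, Function.update d k₁ (d k₁ - x) k =
      ∑ k ∈ (Finset.univ.erase j).erase k₁, d k :=
    Finset.sum_congr rfl fun k hk => Function.update_of_ne (Finset.ne_of_mem_erase hk) _ _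
  rw [lin_eq h1, lin_eq h1, this, Function.update_self]
  ring

lemma level_plug (hn : 3 ≤ n) (h1 : k₁ ≠ j) (hz : z ∈ dom j) :
    level j k₁ (plug j k₁ z) = 0 := by
  have e1 : lin j k₁ (action (trans j (plug j k₁ z))) =
      lin j k₁ (action (trans j z)) - eta (flowTime j z) * gain j k₁ z := by
    rw [← lin_update h1]
    exact lin_congr fun k hk => action_plug hn h1 hz hk
  have e2 : bump j k₁ (action (trans j (plug j k₁ z))) = bump j k₁ (action (trans j z)) :=
    bump_congr fun k hk hk' => by rw [action_plug hn h1 hz hk, Function.update_of_ne hk']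
  rw [level, flowTime_plug hn h1 hz, energy_plug hn h1 hz, e1, sub_add_cancel, prof, e2]
  exact sub_self _

end

section Smooth

variable {m : ℕ∞} {z : EuclideanSpace ℂ (Fin n)}

lemma contDiffAt_lin {X : Type*} [NormedAddCommGroup X] [NormedSpace ℝ X] {d : X → Fin n → ℝ}
    {x : X} (hd : ∀ k ≠ j, ContDiffAt ℝ m (fun y => d y k) x) :
    ContDiffAt ℝ m (fun y => lin j k₁ (d y)) x :=
  ContDiffAt.sum fun k hk => contDiffAt_const.mul (hd k (Finset.ne_of_mem_erase hk))

lemma contDiffAt_bump {X : Type*} [NormedAddCommGroup X] [NormedSpace ℝ X] {d : X → Fin n → ℝ}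
    {x : X} (hd : ∀ k ≠ j, ContDiffAt ℝ m (fun y => d y k) x) :
    ContDiffAt ℝ m (fun y => bump j k₁ (d y)) x := by
  have : ContDiffAt ℝ m (fun y => sqSum j k₁ (d y) / rad n ^ 2) x :=
    (ContDiffAt.sum fun k hk =>
      (hd k (Finset.mem_erase.1 (Finset.mem_of_mem_erase hk)).1).pow 2).div_const _
  exact contDiff_beta.contDiffAt.comp x this

lemma contDiffAt_gain (hz : 0 < (z j).re) : ContDiffAt ℝ m (gain j k₁) z := by
  have h1 : ∀ k ≠ j, ContDiffAt ℝ m (fun w => action (trans j w) k) z :=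
    fun k _ => contDiffAt_action hz
  exact ((contDiff_eta.contDiffAt.comp z (contDiffAt_flowTime hz)).mul
    (contDiffAt_bump h1)).mul (contDiff_psi.contDiffAt.comp z (contDiffAt_lin h1))

lemma contDiffAt_level (hz : 0 < (z j).re) : ContDiffAt ℝ m (level j k₁) z := by
  have h1 : ∀ k ≠ j, ContDiffAt ℝ m (fun w => action (trans j w) k) z :=
    fun k _ => contDiffAt_action hz
  have h2 : ContDiffAt ℝ m (fun w => eta (flowTime j w)) z :=
    contDiff_eta.contDiffAt.comp z (contDiffAt_flowTime hz)
  have h3 : ContDiffAt ℝ m energy z := contDiff_energy.contDiffAt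
  exact h3.sub ((h2.mul (contDiffAt_bump h1)).mul
    (contDiff_psi.contDiffAt.comp z ((contDiffAt_lin h1).add (h2.mul h3))))

lemma contDiffAt_push {h δ : EuclideanSpace ℂ (Fin n) → ℝ} (hz : 0 < (z j).re)
    (hh : ContDiffAt ℝ m h z) (hδ : ContDiffAt ℝ m δ z)
    (h0 : 0 < Complex.normSq (trans j z k₁)) (h0' : 0 < Complex.normSq (trans j z k₁) + 2 * δ z)
    (hp : 0 < axisSq j (h z) (shift k₁ (trans j z) (δ z))) :
    ContDiffAt ℝ m (fun w => push j k₁ w (h w) (δ w)) z := by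
  refine contDiffAt_chart (contDiffAt_flowTime hz) hh (fun k hk => ?_) hp
  have h1 := contDiffAt_trans (m := (m : WithTop ℕ∞)) (k := k) hz
  by_cases hkk : k = k₁
  · subst hkk
    simp only [shift_self]
    have h2 : ContDiffAt ℝ m
        (fun w => √(1 + 2 * δ w / Complex.normSq (trans j w k))) z := by
      refine ContDiffAt.sqrt ?_ ?_
      · have h3 := contDiffAt_normSq h1
        exact contDiffAt_const.add ((contDiffAt_const.mul hδ).div h3 h0.ne')
      · have : 1 + 2 * δ z / Complex.normSq (trans j z k) =
          (Complex.normSq (trans j z k) + 2 * δ z) / Complex.normSq (trans j z k) := by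
            field_simp
        rw [this]
        positivity
    fun_prop
  · simpa only [shift_of_ne hkk] using h1

lemma contDiffAt_plug (hn : 3 ≤ n) (h1 : k₁ ≠ j) (hz : z ∈ dom j) :
    ContDiffAt ℝ m (plug j k₁) z := by
  have hg := contDiffAt_gain (m := m) (k₁ := k₁) hz.1
  have h2 : ContDiffAt ℝ m (fun w => eta (flowTime j w)) z :=
    contDiff_eta.contDiffAt.comp z (contDiffAt_flowTime hz.1)
  exact contDiffAt_push hz.1 hg (h2.mul hg).neg (normSq_trans_pos h1 hz)
    (normSq_add_pos hn h1 hz abs_shift_plug_le) (axisSq_plug_pos hn h1 hz)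

lemma contDiffAt_unplug_plug (hn : 3 ≤ n) (h1 : k₁ ≠ j) (hz : z ∈ dom j) :
    ContDiffAt ℝ m (unplug j k₁) (plug j k₁ z) := by
  have hq := plug_mem_dom hn h1 hz
  have h2 : ContDiffAt ℝ m (fun w => eta (flowTime j w)) (plug j k₁ z) :=
    contDiff_eta.contDiffAt.comp _ (contDiffAt_flowTime hq.1)
  have hb : |eta (flowTime j (plug j k₁ z)) * energy (plug j k₁ z)| ≤ rad n := by
    rw [energy_plug hn h1 hz]
    exact abs_eta_mul_le (abs_eta_le _) (abs_gain_le z)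
  refine contDiffAt_push hq.1 contDiffAt_const (h2.mul contDiff_energy.contDiffAt)
    (normSq_trans_pos h1 hq) (normSq_add_pos hn h1 hq hb) ?_
  have h3 : axisSq j 0 (shift k₁ (trans j (plug j k₁ z))
      (eta (flowTime j (plug j k₁ z)) * energy (plug j k₁ z))) = axisSq j 0 (trans j z) := by
    refine axisSq_congr fun k hk => ?_
    rw [flowTime_plug hn h1 hz, energy_plug hn h1 hz]
    rw [shift_trans_plug hn h1 hz hk]
  rw [h3]
  exact axisSq_pos (by norm_num) hz.2

end Smooth

end HamiltonianSeifert

namespace HamiltonianSeifert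

open Filter Topology Set
open scoped ContDiff RealInnerProductSpace

/-! ### The embedding of the sphere -/

variable {n : ℕ} {j : Fin n} {κ : Fin n → Fin n}

/-- Componentwise real scaling. -/
noncomputable def scale (c : Fin n → ℝ) (x : EuclideanSpace ℂ (Fin n)) :
    EuclideanSpace ℂ (Fin n) :=
  WithLp.toLp 2 fun k => (c k : ℂ) * x k

lemma contDiff_scale {m : WithTop ℕ∞} (c : Fin n → ℝ) : ContDiff ℝ m (scale c) := by
  refine contDiff_piLp' _ fun k => ?_
  simp only [scale]
  fun_prop

/-- The semi-axes of the model ellipsoid. -/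
noncomputable def semiAxis (k : Fin n) : ℝ := √(20 * n / freq k)

lemma semiAxis_pos (k : Fin n) : 0 < semiAxis k := by
  have : (0 : ℝ) < n := by exact_mod_cast k.pos
  have := freq_pos k
  unfold semiAxis
  positivity

/-- The radial projection onto the model ellipsoid. -/
noncomputable def ell (x : EuclideanSpace ℂ (Fin n)) : EuclideanSpace ℂ (Fin n) :=
  ‖x‖⁻¹ • scale semiAxis x

lemma ell_apply (x : EuclideanSpace ℂ (Fin n)) (k : Fin n) :
    ell x k = ((‖x‖⁻¹ * semiAxis k : ℝ) : ℂ) * x k := by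
  simp [ell, scale, mul_assoc]

lemma energy_ell {x : EuclideanSpace ℂ (Fin n)} (hx : x ≠ 0) : energy (ell x) = 0 := by
  have hx' : ‖x‖ ≠ 0 := norm_ne_zero_iff.2 hx
  have key : ∀ k, freq k * Complex.normSq (ell x k) / 2 =
      10 * n / ‖x‖ ^ 2 * ‖x k‖ ^ 2 := by
    intro k
    have hn : (0 : ℝ) < n := by exact_mod_cast k.pos
    have h := freq_pos k
    have h2 : semiAxis k ^ 2 = 20 * n / freq k := Real.sq_sqrt (by positivity)
    rw [ell_apply, Complex.normSq_mul, Complex.normSq_ofReal, Complex.normSq_eq_norm_sq,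
      show ‖x‖⁻¹ * semiAxis k * (‖x‖⁻¹ * semiAxis k) = semiAxis k ^ 2 / ‖x‖ ^ 2 by
        field_simp, h2]
    field_simp
    ring
  rw [energy, Finset.sum_congr rfl fun k _ => key k, ← Finset.mul_sum,
    ← EuclideanSpace.norm_sq_eq]
  field_simp
  ring

lemma norm_smul_scale_ell {x : EuclideanSpace ℂ (Fin n)} (hx : x ≠ 0) :
    ‖x‖ • scale (fun k => (semiAxis k)⁻¹) (ell x) = x := by
  have hx' : ‖x‖ ≠ 0 := norm_ne_zero_iff.2 hx
  ext k
  have h := (semiAxis_pos k).ne'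
  have e : (‖x‖ * ((semiAxis k)⁻¹ * (‖x‖⁻¹ * semiAxis k))) = 1 := by field_simp
  simp only [PiLp.smul_apply, scale, ell_apply, Complex.real_smul]
  rw [← mul_assoc, ← mul_assoc, ← Complex.ofReal_mul, mul_assoc, ← mul_assoc,
    ← Complex.ofReal_mul, mul_assoc, e]
  simp

lemma contDiffAt_ell {m : WithTop ℕ∞} {x : EuclideanSpace ℂ (Fin n)} (hx : x ≠ 0) :
    ContDiffAt ℝ m ell x :=
  ((contDiffAt_norm ℝ hx).inv (norm_ne_zero_iff.2 hx)).smul (contDiff_scale _).contDiffAt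

lemma eventually_energy_ell {x : EuclideanSpace ℂ (Fin n)} (hx : x ≠ 0)
    {p : EuclideanSpace ℂ (Fin n) → Prop} (h : ∀ᶠ z in 𝓝 (ell x), energy z = 0 → p z) :
    ∀ᶠ y in 𝓝 x, p (ell y) := by
  have hc : ContinuousAt ell x := (contDiffAt_ell (m := 0) hx).continuousAt
  filter_upwards [hc.eventually h, isOpen_ne.mem_nhds hx] with y hy hy0
  exact hy (energy_ell hy0)

open Classical in
/-- The deformation of the model ellipsoid by all the plugs. -/
noncomputable def plugMap (κ : Fin n → Fin n) (z : EuclideanSpace ℂ (Fin n)) :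
    EuclideanSpace ℂ (Fin n) :=
  if h : ∃ j, z ∈ dom j then plug h.choose (κ h.choose) z else z

open Classical in
/-- A left inverse of `plugMap` on the model ellipsoid. -/
noncomputable def unplugMap (κ : Fin n → Fin n) (z : EuclideanSpace ℂ (Fin n)) :
    EuclideanSpace ℂ (Fin n) :=
  if h : ∃ j, z ∈ dom j then unplug h.choose (κ h.choose) z else z

section

variable {z : EuclideanSpace ℂ (Fin n)}

lemma plugMap_of_mem (hn : 3 ≤ n) (he : -1 ≤ energy z) (hz : z ∈ dom j) :
    plugMap κ z = plug j (κ j) z := by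
  have h : ∃ j, z ∈ dom j := ⟨j, hz⟩
  rw [plugMap, dif_pos h, eq_of_mem_dom hn he h.choose_spec hz]

lemma unplugMap_of_mem (hn : 3 ≤ n) (he : -1 ≤ energy z) (hz : z ∈ dom j) :
    unplugMap κ z = unplug j (κ j) z := by
  have h : ∃ j, z ∈ dom j := ⟨j, hz⟩
  rw [unplugMap, dif_pos h, eq_of_mem_dom hn he h.choose_spec hz]

lemma plugMap_of_forall_not_mem (hz : ∀ j, z ∉ dom j) : plugMap κ z = z := by
  rw [plugMap, dif_neg (by push Not; exact hz)]

lemma unplugMap_of_forall_not_mem (hz : ∀ j, z ∉ dom j) : unplugMap κ z = z := by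
  rw [unplugMap, dif_neg (by push Not; exact hz)]

lemma abs_energy_plugMap_le (hn : 3 ≤ n) (hκ : ∀ j, κ j ≠ j) (he : energy z = 0) :
    |energy (plugMap κ z)| ≤ rad n := by
  by_cases h : ∃ j, z ∈ dom j
  · obtain ⟨j, hj⟩ := h
    rw [plugMap_of_mem hn (by rw [he]; norm_num) hj, energy_plug hn (hκ j) hj]
    exact abs_gain_le z
  · rw [plugMap_of_forall_not_mem (by push Not at h; exact h), he, abs_zero]
    exact (rad_pos ⟨0, by omega⟩).le

lemma neg_one_le_energy_plugMap (hn : 3 ≤ n) (hκ : ∀ j, κ j ≠ j) (he : energy z = 0) :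
    -1 ≤ energy (plugMap κ z) := by
  linarith [(abs_le.1 (abs_energy_plugMap_le hn hκ he)).1, rad_le hn]

lemma mem_dom_of_plugMap_mem (hn : 3 ≤ n) (hκ : ∀ j, κ j ≠ j) (he : energy z = 0)
    (h : plugMap κ z ∈ dom j) : z ∈ dom j := by
  by_cases hz : ∃ l, z ∈ dom l
  · obtain ⟨l, hl⟩ := hz
    have h2 := plug_mem_dom hn (hκ l) hl
    rw [← plugMap_of_mem hn (by rw [he]; norm_num) hl] at h2
    rwa [eq_of_mem_dom hn (neg_one_le_energy_plugMap hn hκ he) h h2]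
  · rwa [plugMap_of_forall_not_mem (by push Not at hz; exact hz)] at h

lemma plugMap_mem_dom (hn : 3 ≤ n) (hκ : ∀ j, κ j ≠ j) (he : energy z = 0)
    (h : z ∈ dom j) : plugMap κ z ∈ dom j := by
  rw [plugMap_of_mem hn (by rw [he]; norm_num) h]
  exact plug_mem_dom hn (hκ j) h

lemma unplugMap_plugMap (hn : 3 ≤ n) (hκ : ∀ j, κ j ≠ j) (he : energy z = 0) :
    unplugMap κ (plugMap κ z) = z := by
  by_cases h : ∃ j, z ∈ dom j
  · obtain ⟨j, hj⟩ := h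
    rw [unplugMap_of_mem hn (neg_one_le_energy_plugMap hn hκ he) (plugMap_mem_dom hn hκ he hj),
      plugMap_of_mem hn (by rw [he]; norm_num) hj, unplug_plug hn (hκ j) hj he]
  · push Not at h
    rw [plugMap_of_forall_not_mem h, unplugMap_of_forall_not_mem h]

lemma eventually_plugMap_eq_plug (hn : 3 ≤ n) (hz : z ∈ dom j) :
    ∀ᶠ w in 𝓝 z, energy w = 0 → plugMap κ w = plug j (κ j) w := by
  filter_upwards [(isOpen_dom j).mem_nhds hz] with w hw he
  exact plugMap_of_mem hn (by rw [he]; norm_num) hw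

lemma eventually_plugMap_eq_self (hn : 3 ≤ n) (hκ : ∀ j, κ j ≠ j) (hz : ∀ j, z ∉ dom j) :
    ∀ᶠ w in 𝓝 z, energy w = 0 → plugMap κ w = w := by
  filter_upwards [eventually_all.2 fun j => eventually_of_not_mem_dom hn (hz j)] with w hw he
  have he' : -1 ≤ energy w := by rw [he]; norm_num
  by_cases h : ∃ j, w ∈ dom j
  · obtain ⟨j, hj⟩ := h
    rw [plugMap_of_mem hn he' hj]
    exact plug_eq_self he (gain_eq_zero hn (hκ j) (hw j he' hj))
  · push Not at h
    exact plugMap_of_forall_not_mem h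

end

/-- The smooth map whose restriction to the unit sphere is the embedding. -/
noncomputable def embed (κ : Fin n → Fin n) (x : EuclideanSpace ℂ (Fin n)) :
    EuclideanSpace ℂ (Fin n) :=
  Real.smoothTransition (4 * ‖x‖ ^ 2 - 1) • plugMap κ (ell x)

variable {x : EuclideanSpace ℂ (Fin n)}

lemma contDiffAt_plugMap_ell {m : ℕ∞} (hn : 3 ≤ n) (hκ : ∀ j, κ j ≠ j) (hx : x ≠ 0) :
    ContDiffAt ℝ m (fun y => plugMap κ (ell y)) x := by
  by_cases h : ∃ j, ell x ∈ dom j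
  · obtain ⟨j, hj⟩ := h
    refine ContDiffAt.congr_of_eventuallyEq ?_
      (eventually_energy_ell hx (eventually_plugMap_eq_plug hn hj))
    exact (contDiffAt_plug hn (hκ j) hj).comp x (contDiffAt_ell hx)
  · push Not at h
    exact (contDiffAt_ell hx).congr_of_eventuallyEq
      (eventually_energy_ell hx (eventually_plugMap_eq_self hn hκ h))

lemma contDiff_embed {m : ℕ∞} (hn : 3 ≤ n) (hκ : ∀ j, κ j ≠ j) : ContDiff ℝ m (embed κ) := by
  rw [contDiff_iff_contDiffAt]
  intro x
  by_cases hx : x = 0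
  · subst hx
    refine (contDiffAt_const (c := (0 : EuclideanSpace ℂ (Fin n)))).congr_of_eventuallyEq ?_
    have hc : ContinuousAt (fun y : EuclideanSpace ℂ (Fin n) => 4 * ‖y‖ ^ 2 - 1) 0 := by fun_prop
    filter_upwards [hc.eventually_lt continuousAt_const (show 4 * ‖(0 : EuclideanSpace ℂ (Fin n))‖
      ^ 2 - 1 < 0 by simp)] with y hy
    rw [embed, Real.smoothTransition.zero_of_nonpos hy.le, zero_smul]
  · have h1 : ContDiffAt ℝ m (fun y : EuclideanSpace ℂ (Fin n) =>
        Real.smoothTransition (4 * ‖y‖ ^ 2 - 1)) x :=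
      Real.smoothTransition.contDiff.contDiffAt.comp x
        ((contDiffAt_const.mul (contDiff_norm_sq ℝ).contDiffAt).sub contDiffAt_const)
    exact h1.smul (contDiffAt_plugMap_ell hn hκ hx)

lemma ne_zero_of_norm_eq_one (hx : ‖x‖ = 1) : x ≠ 0 := norm_ne_zero_iff.1 (by simp [hx])

lemma eventually_embed_eq (hx : ‖x‖ = 1) : ∀ᶠ y in 𝓝 x, embed κ y = plugMap κ (ell y) := by
  have hc : ContinuousAt (fun y : EuclideanSpace ℂ (Fin n) => 4 * ‖y‖ ^ 2 - 1) x := by fun_prop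
  filter_upwards [continuousAt_const.eventually_lt hc
    (show 1 < 4 * ‖x‖ ^ 2 - 1 by rw [hx]; norm_num)] with y hy
  rw [embed, Real.smoothTransition.one_of_one_le hy.le, one_smul]

lemma embed_eq (hx : ‖x‖ = 1) : embed κ x = plugMap κ (ell x) :=
  (eventually_embed_eq hx).self_of_nhds

/-- The left inverse of the embedding, up to normalization. -/
noncomputable def unembed (κ : Fin n → Fin n) (q : EuclideanSpace ℂ (Fin n)) :
    EuclideanSpace ℂ (Fin n) :=
  scale (fun k => (semiAxis k)⁻¹) (unplugMap κ q)

lemma norm_smul_unembed (hn : 3 ≤ n) (hκ : ∀ j, κ j ≠ j) (hx : x ≠ 0) :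
    ‖x‖ • unembed κ (plugMap κ (ell x)) = x := by
  rw [unembed, unplugMap_plugMap hn hκ (energy_ell hx), norm_smul_scale_ell hx]

lemma injOn_embed (hn : 3 ≤ n) (hκ : ∀ j, κ j ≠ j) :
    InjOn (embed κ) (Metric.sphere (0 : EuclideanSpace ℂ (Fin n)) 1) := by
  intro x hx y hy hxy
  rw [mem_sphere_zero_iff_norm] at hx hy
  have h1 := norm_smul_unembed hn hκ (ne_zero_of_norm_eq_one hx)
  have h2 := norm_smul_unembed hn hκ (ne_zero_of_norm_eq_one hy)
  rw [embed_eq hx, embed_eq hy] at hxy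
  rw [← h1, ← h2, hxy, hx, hy]

/-- If `x` can be smoothly recovered from `F x` and `‖x‖`, then `F` is immersive on the sphere. -/
lemma fderiv_ne_zero_of_left_inverse {F G : EuclideanSpace ℂ (Fin n) → EuclideanSpace ℂ (Fin n)}
    (hx : ‖x‖ = 1) (hF : DifferentiableAt ℝ F x) (hG : DifferentiableAt ℝ G (F x))
    (h : ∀ᶠ y in 𝓝 x, ‖y‖ • G (F y) = y) {v : EuclideanSpace ℂ (Fin n)}
    (hv : ⟪v, x⟫ = 0) (hv0 : v ≠ 0) : fderiv ℝ F x v ≠ 0 := by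
  intro hD
  have hx0 := ne_zero_of_norm_eq_one hx
  have h1 := ((contDiffAt_norm (n := 1) ℝ hx0).differentiableAt (by simp)).hasFDerivAt.smul
    (hG.hasFDerivAt.comp x hF.hasFDerivAt)
  have h2 := (h1.congr_of_eventuallyEq (h.mono fun y hy => by
    simpa using hy.symm)).unique (hasFDerivAt_id (𝕜 := ℝ) x)
  have h3 := DFunLike.congr_fun h2 v
  have h4 := h.self_of_nhds
  rw [hx, one_smul] at h4
  simp only [Function.comp_apply, h4, hD, add_apply,
    smul_apply, ContinuousLinearMap.comp_apply, map_zero, smul_zero, zero_add,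
    ContinuousLinearMap.smulRight_apply, ContinuousLinearMap.id_apply] at h3
  rw [← h3, real_inner_smul_left, real_inner_self_eq_norm_sq, hx] at hv
  rw [one_pow, mul_one] at hv
  rw [hv, zero_smul] at h3
  exact hv0 h3.symm

lemma fderiv_embed_ne_zero (hn : 3 ≤ n) (hκ : ∀ j, κ j ≠ j) (hx : ‖x‖ = 1)
    {v : EuclideanSpace ℂ (Fin n)} (hv : ⟪v, x⟫ = 0) (hv0 : v ≠ 0) :
    fderiv ℝ (embed κ) x v ≠ 0 := by
  have hx0 := ne_zero_of_norm_eq_one hx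
  have hF : DifferentiableAt ℝ (embed κ) x :=
    (contDiff_embed (m := 1) hn hκ).differentiable (by simp) x
  have hs : ∀ q, DifferentiableAt ℝ (scale fun k : Fin n => (semiAxis k)⁻¹) q := fun q =>
    (contDiff_scale (m := 1) _).differentiable (by simp) q
  by_cases h : ∃ j, ell x ∈ dom j
  · obtain ⟨j, hj⟩ := h
    refine fderiv_ne_zero_of_left_inverse
      (G := fun q => scale (fun k => (semiAxis k)⁻¹) (unplug j (κ j) q)) hx hF ?_ ?_ hv hv0
    · have h1 := (contDiffAt_unplug_plug (m := 1) hn (hκ j) hj).differentiableAt (by simp)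
      rw [embed_eq hx, plugMap_of_mem hn (by rw [energy_ell hx0]; norm_num) hj]
      exact (hs _).comp _ h1
    · filter_upwards [eventually_embed_eq (κ := κ) hx, isOpen_ne.mem_nhds hx0,
        (contDiffAt_ell (m := 0) hx0).continuousAt.eventually ((isOpen_dom j).mem_nhds hj)]
        with y hy hy0 hyj
      have h2 := norm_smul_unembed hn hκ hy0
      have h3 := energy_ell hy0
      rwa [unembed, unplugMap_of_mem hn (neg_one_le_energy_plugMap hn hκ h3)
        (plugMap_mem_dom hn hκ h3 hyj), ← hy] at h2
  · push Not at h
    refine fderiv_ne_zero_of_left_inverse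
      (G := fun q => scale (fun k => (semiAxis k)⁻¹) q) hx hF (hs _) ?_ hv hv0
    filter_upwards [eventually_embed_eq (κ := κ) hx, isOpen_ne.mem_nhds hx0,
      eventually_energy_ell hx0 (eventually_plugMap_eq_self hn hκ h)] with y hy hy0 hyj
    rw [hy, hyj, norm_smul_scale_ell hy0]

/-! ### The image of the embedding -/

lemma neg_one_le_energy_embed (hn : 3 ≤ n) (hκ : ∀ j, κ j ≠ j) (hx : ‖x‖ = 1) :
    -1 ≤ energy (embed κ x) := by
  rw [embed_eq hx]
  exact neg_one_le_energy_plugMap hn hκ (energy_ell (ne_zero_of_norm_eq_one hx))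

lemma eventually_level_embed (hn : 3 ≤ n) (hκ : ∀ j, κ j ≠ j) (hx : ‖x‖ = 1)
    (hj : embed κ x ∈ dom j) : ∀ᶠ y in 𝓝 x, level j (κ j) (embed κ y) = 0 := by
  have hx0 := ne_zero_of_norm_eq_one hx
  rw [embed_eq hx] at hj
  have hj' := mem_dom_of_plugMap_mem hn hκ (energy_ell hx0) hj
  filter_upwards [eventually_embed_eq (κ := κ) hx, isOpen_ne.mem_nhds hx0,
    (contDiffAt_ell (m := 0) hx0).continuousAt.eventually ((isOpen_dom j).mem_nhds hj')]
    with y hy hy0 hyj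
  rw [hy, plugMap_of_mem hn (by rw [energy_ell hy0]; norm_num) hyj, level_plug hn (hκ j) hyj]

lemma eventually_energy_embed (hn : 3 ≤ n) (hκ : ∀ j, κ j ≠ j) (hx : ‖x‖ = 1)
    (hj : ∀ j, embed κ x ∉ dom j) : ∀ᶠ y in 𝓝 x, energy (embed κ y) = 0 := by
  have hx0 := ne_zero_of_norm_eq_one hx
  have hj' : ∀ j, ell x ∉ dom j := fun j h => hj j <| by
    rw [embed_eq hx]
    exact plugMap_mem_dom hn hκ (energy_ell hx0) h
  filter_upwards [eventually_embed_eq (κ := κ) hx, isOpen_ne.mem_nhds hx0,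
    eventually_energy_ell hx0 (eventually_plugMap_eq_self hn hκ hj')] with y hy hy0 hyj
  rw [hy, hyj, energy_ell hy0]

end HamiltonianSeifert

namespace HamiltonianSeifert

open Filter Topology Set
open scoped ContDiff RealInnerProductSpace ComplexConjugate

/-! ### Symplectic linear algebra -/

variable {n : ℕ} {j k₁ : Fin n}

lemma stdSymp_eq_sum (u v : EuclideanSpace ℂ (Fin n)) :
    stdSymp n u v = ∑ k, (conj (u k) * v k).im := by
  simp only [stdSymp, PiLp.inner_apply, PiLp.smul_apply]
  refine Finset.sum_congr rfl fun k _ => ?_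
  simp [Complex.inner]
  ring

lemma eq_neg_I_mul_of_im_conj_mul {w z : ℂ} {c : ℝ}
    (h : ∀ v : ℂ, (conj w * v).im = c * (conj z * v).re) : w = -(c : ℂ) * Complex.I * z := by
  have h1 := h 1
  have h2 := h Complex.I
  simp at h1 h2
  apply Complex.ext <;> simp <;> linarith

lemma stdSymp_toLp_single (w : EuclideanSpace ℂ (Fin n)) (k : Fin n) (v : ℂ) :
    stdSymp n w (WithLp.toLp 2 (Pi.single k v)) = (conj (w k) * v).im := by
  rw [stdSymp_eq_sum, Finset.sum_eq_single k]
  · simp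
  · intro l _ hl
    simp [hl]
  · simp

/-- A vector symplectically orthogonal to a hypersurface is a multiple of its Hamiltonian
direction. -/
lemma exists_multiplier {F : EuclideanSpace ℂ (Fin n) → EuclideanSpace ℂ (Fin n)}
    {K : EuclideanSpace ℂ (Fin n) → ℝ} {x w : EuclideanSpace ℂ (Fin n)}
    {dK : EuclideanSpace ℂ (Fin n) →L[ℝ] ℝ} (hx : ‖x‖ = 1) (hF : DifferentiableAt ℝ F x)
    (hi : ∀ v : EuclideanSpace ℂ (Fin n), ⟪v, x⟫ = 0 → v ≠ 0 → fderiv ℝ F x v ≠ 0)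
    (hK : HasFDerivAt K dK (F x)) (hKF : ∀ᶠ y in 𝓝 x, K (F y) = 0) (hdK : dK ≠ 0) (hw : w ≠ 0)
    (ho : ∀ v : EuclideanSpace ℂ (Fin n), ⟪v, x⟫ = 0 → stdSymp n w (fderiv ℝ F x v) = 0) :
    ∃ c : ℝ, c ≠ 0 ∧ ∀ v, stdSymp n w v = c * dK v := by
  have hx0 : x ≠ 0 := ne_zero_of_norm_eq_one hx
  have hdKF : ∀ v, dK (fderiv ℝ F x v) = 0 := by
    intro v
    have h1 := (hK.comp x hF.hasFDerivAt).congr_of_eventuallyEq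
      (hKF.mono fun y hy => by simpa using hy.symm)
    have h2 := h1.unique (hasFDerivAt_const (0 : ℝ) x)
    exact DFunLike.congr_fun h2 v
  let N : Submodule ℝ (EuclideanSpace ℂ (Fin n)) := LinearMap.ker (innerSL ℝ x).toLinearMap
  have hN : ∀ v, v ∈ N ↔ ⟪v, x⟫ = 0 := fun v => by
    simp [N, real_inner_comm]
  have hinj : Function.Injective ((fderiv ℝ F x).toLinearMap.domRestrict N) := by
    rw [← LinearMap.ker_eq_bot, LinearMap.ker_eq_bot']
    rintro ⟨v, hv⟩ h
    by_contra hne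
    exact hi v ((hN v).1 hv) (fun h0 => hne (by ext1; exact h0)) h
  have hfr := LinearMap.finrank_range_of_inj hinj
  have h1 : Module.finrank ℝ N + 1 = Module.finrank ℝ (EuclideanSpace ℂ (Fin n)) :=
    Module.Dual.finrank_ker_add_one_of_ne_zero (K := ℝ)
    (f := (innerSL ℝ x).toLinearMap) (fun h => hx0 <| by
      have := LinearMap.congr_fun h x
      simpa using this)
  have h2 : Module.finrank ℝ (LinearMap.ker dK.toLinearMap) + 1 =
      Module.finrank ℝ (EuclideanSpace ℂ (Fin n)) :=
    Module.Dual.finrank_ker_add_one_of_ne_zero (K := ℝ)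
    (f := dK.toLinearMap) (fun h => hdK <| by
      ext v
      exact LinearMap.congr_fun h v)
  have hle : LinearMap.range ((fderiv ℝ F x).toLinearMap.domRestrict N) ≤
      LinearMap.ker dK.toLinearMap := by
    rintro _ ⟨v, rfl⟩
    exact hdKF v
  have heq := Submodule.eq_of_le_of_finrank_eq hle (by rw [hfr]; omega)
  obtain ⟨v₀, hv₀⟩ : ∃ v₀, dK v₀ ≠ 0 := by
    by_contra! h
    exact hdK (by ext v; exact h v)
  have hlin : ∀ v, stdSymp n w v = stdSymp n w v₀ / dK v₀ * dK v := by
    intro v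
    have hk : v - (dK v / dK v₀) • v₀ ∈ LinearMap.ker dK.toLinearMap := by
      simp [hv₀]
    rw [← heq] at hk
    obtain ⟨⟨y, hy⟩, hyv⟩ := hk
    have h3 := ho y ((hN y).1 hy)
    rw [show fderiv ℝ F x y = v - (dK v / dK v₀) • v₀ from hyv, stdSymp, inner_sub_right,
      real_inner_smul_right] at h3
    rw [stdSymp, stdSymp]
    field_simp at h3 ⊢
    linarith
  refine ⟨_, fun h0 => hw ?_, hlin⟩
  have h3 := hlin (Complex.I • w)
  rw [h0, zero_mul, stdSymp, inner_self_eq_zero] at h3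
  simpa using h3

/-! ### Velocities in flow-box coordinates -/

/-- `V` is the tangent vector at `chart j t h u` with coordinates `t'`, `h'`, `u'`. -/
def IsChartVelocity (j : Fin n) (t h : ℝ) (u : Fin n → ℂ) (t' h' : ℝ) (u' : Fin n → ℂ)
    (V : EuclideanSpace ℂ (Fin n)) : Prop :=
  ∃ r' : ℝ, freq j * √(2 / freq j * axisSq j h u) * r' =
      h' - ∑ k ∈ Finset.univ.erase j, freq k * (conj (u k - 1) * u' k).re ∧
    V j = Complex.exp ((freq j * t : ℝ) * Complex.I) *
      (r' + Complex.I * (freq j * t' : ℝ) * (√(2 / freq j * axisSq j h u) : ℂ)) ∧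
    ∀ k ≠ j, V k = Complex.exp ((freq k * t : ℝ) * Complex.I) *
      (u' k + Complex.I * (freq k * t' : ℝ) * (u k - 1))

lemma conj_exp_mul (x : ℝ) (a b : ℂ) :
    conj (Complex.exp ((x : ℝ) * Complex.I) * a) * (Complex.exp ((x : ℝ) * Complex.I) * b) =
      conj a * b := by
  have : conj (Complex.exp ((x : ℝ) * Complex.I)) * Complex.exp ((x : ℝ) * Complex.I) = 1 := by
    rw [mul_comm, Complex.mul_conj, Complex.normSq_eq_norm_sq, Complex.norm_exp_ofReal_mul_I]
    simp
  rw [map_mul]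
  linear_combination (conj a * b) * this

lemma stdSymp_of_isChartVelocity {t h : ℝ} {u : Fin n → ℂ} {t₁ h₁ t₂ h₂ : ℝ}
    {u₁ u₂ : Fin n → ℂ} {V₁ V₂ : EuclideanSpace ℂ (Fin n)}
    (hV₁ : IsChartVelocity j t h u t₁ h₁ u₁ V₁) (hV₂ : IsChartVelocity j t h u t₂ h₂ u₂ V₂) :
    stdSymp n V₁ V₂ =
      ∑ k ∈ Finset.univ.erase j, (conj (u₁ k) * u₂ k).im + t₂ * h₁ - t₁ * h₂ := by
  obtain ⟨r₁, hr₁, hj₁, hk₁⟩ := hV₁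
  obtain ⟨r₂, hr₂, hj₂, hk₂⟩ := hV₂
  have key : ∀ k ∈ Finset.univ.erase j, (conj (V₁ k) * V₂ k).im = (conj (u₁ k) * u₂ k).im +
      t₂ * (freq k * (conj (u k - 1) * u₁ k).re) -
      t₁ * (freq k * (conj (u k - 1) * u₂ k).re) := by
    intro k hk
    have hk' := Finset.ne_of_mem_erase hk
    rw [hk₁ k hk', hk₂ k hk', conj_exp_mul]
    simp
    ring
  rw [stdSymp_eq_sum, ← Finset.add_sum_erase _ _ (Finset.mem_univ j), Finset.sum_congr rfl key,
    Finset.sum_sub_distrib, Finset.sum_add_distrib, ← Finset.mul_sum, ← Finset.mul_sum, hj₁, hj₂,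
    conj_exp_mul]
  generalize ∑ k ∈ Finset.univ.erase j, (conj (u₁ k) * u₂ k).im = S at *
  generalize ∑ k ∈ Finset.univ.erase j, freq k * (conj (u k - 1) * u₁ k).re = S₁ at *
  generalize ∑ k ∈ Finset.univ.erase j, freq k * (conj (u k - 1) * u₂ k).re = S₂ at *
  simp
  linear_combination t₂ * hr₁ - t₁ * hr₂

lemma hasDerivAt_normSq {f : ℝ → ℂ} {f' : ℂ} {s : ℝ} (hf : HasDerivAt f f' s) :
    HasDerivAt (fun x => Complex.normSq (f x)) (2 * (conj (f s) * f').re) s := by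
  have h1 : HasDerivAt (fun x => (f x).re) f'.re s :=
    (Complex.reCLM.hasFDerivAt.comp_hasDerivAt s hf)
  have h2 : HasDerivAt (fun x => (f x).im) f'.im s :=
    (Complex.imCLM.hasFDerivAt.comp_hasDerivAt s hf)
  have h3 : (fun x => Complex.normSq (f x)) =
      fun x => (f x).re * (f x).re + (f x).im * (f x).im :=
    funext fun _ => Complex.normSq_apply _
  rw [h3]
  refine ((h1.fun_mul h1).fun_add (h2.fun_mul h2)).congr_deriv ?_
  simp
  ring

lemma hasDerivAt_action {u : ℝ → Fin n → ℂ} {u' : Fin n → ℂ} {s : ℝ} {k : Fin n}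
    (hu : HasDerivAt (fun x => u x k) (u' k) s) :
    HasDerivAt (fun x => action (u x) k) ((conj (u s k) * u' k).re) s := by
  exact (((hasDerivAt_normSq hu).sub_const 1).div_const 2).congr_deriv (by ring)

lemma exists_isChartVelocity {t h : ℝ → ℝ} {u : ℝ → Fin n → ℂ} {t' h' : ℝ} {u' : Fin n → ℂ}
    {s : ℝ} (ht : HasDerivAt t t' s) (hh : HasDerivAt h h' s)
    (hu : ∀ k ≠ j, HasDerivAt (fun x => u x k) (u' k) s) (hp : 0 < axisSq j (h s) (u s)) :
    ∃ V, HasDerivAt (fun x => chart j (t x) (h x) (u x)) V s ∧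
      IsChartVelocity j (t s) (h s) (u s) t' h' u' V := by
  have ha := freq_pos j
  have he : ∀ k : Fin n, HasDerivAt (fun x => Complex.exp ((freq k * t x : ℝ) * Complex.I))
      (Complex.exp ((freq k * t s : ℝ) * Complex.I) * ((freq k * t' : ℝ) * Complex.I)) s :=
    fun k => ((ht.const_mul (freq k)).ofReal_comp.mul_const Complex.I).cexp
  have hA : HasDerivAt (fun x => 2 / freq j * axisSq j (h x) (u x)) (2 / freq j *
      (h' - ∑ k ∈ Finset.univ.erase j, freq k * (conj (u s k - 1) * u' k).re)) s := by
    refine HasDerivAt.const_mul _ ?_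
    unfold axisSq
    refine (hh.const_add _).sub (HasDerivAt.fun_sum fun k hk => ?_)
    exact (((hasDerivAt_normSq ((hu k (Finset.ne_of_mem_erase hk)).sub_const 1)).const_mul
      (freq k)).div_const 2).congr_deriv (by ring)
  have hpos : 0 < 2 / freq j * axisSq j (h s) (u s) := by positivity
  have hr := hA.sqrt hpos.ne'
  have hr0 := Real.sqrt_pos.2 hpos
  set r := √(2 / freq j * axisSq j (h s) (u s)) with hrdef
  set D := h' - ∑ k ∈ Finset.univ.erase j, freq k * (conj (u s k - 1) * u' k).re
  refine ⟨WithLp.toLp 2 fun k => Complex.exp ((freq k * t s : ℝ) * Complex.I) *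
    if k = j then ((2 / freq j * D / (2 * r) : ℝ) + Complex.I * (freq j * t' : ℝ) * (r : ℂ))
    else (u' k + Complex.I * (freq k * t' : ℝ) * (u s k - 1)), ?_,
    2 / freq j * D / (2 * r), ?_, ?_, ?_⟩
  · rw [hasDerivAt_iff_hasFDerivAt, ← hasFDerivWithinAt_univ, hasFDerivWithinAt_piLp]
    intro k
    rw [hasFDerivWithinAt_univ]
    have : HasDerivAt (fun x => chart j (t x) (h x) (u x) k)
        (Complex.exp ((freq k * t s : ℝ) * Complex.I) *
    if k = j then ((2 / freq j * D / (2 * r) : ℝ) + Complex.I * (freq j * t' : ℝ) * (r : ℂ))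
    else (u' k + Complex.I * (freq k * t' : ℝ) * (u s k - 1))) s := by
      by_cases hk : k = j
      · subst hk
        simp only [chart_axis, if_true]
        refine ((he k).fun_mul hr.ofReal_comp).congr_deriv ?_
        rw [← hrdef]
        ring
      · simp only [chart_of_ne hk, if_neg hk]
        refine ((he k).fun_mul ((hu k hk).sub_const 1)).congr_deriv ?_
        ring
    refine this.hasFDerivAt.congr_fderiv ?_
    ext
    simp
  · rw [← hrdef]
    field_simp
    rfl
  · simp [hrdef]
  · intro k hk
    simp [hk]

end HamiltonianSeifert

namespace HamiltonianSeifert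

open Filter Topology Set
open scoped ContDiff RealInnerProductSpace ComplexConjugate

/-! ### The differential of the defining function in flow-box coordinates -/

variable {n : ℕ} {j k₁ : Fin n}

/-- The derivative of the cutoff `bump` with respect to the action of index `k`. -/
noncomputable def dbump (j k₁ : Fin n) (d : Fin n → ℝ) (k : Fin n) : ℝ :=
  if k = k₁ then 0 else deriv beta (sqSum j k₁ d / rad n ^ 2) * (2 * d k / rad n ^ 2)

/-- The derivative of the defining function with respect to the energy. -/
noncomputable def slopeH (j k₁ : Fin n) (e y : ℝ) (d : Fin n → ℝ) : ℝ :=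
  1 - e ^ 2 * bump j k₁ d * dpsi (rad n) y

/-- The derivative of the defining function with respect to the action of index `k`. -/
noncomputable def slope (j k₁ : Fin n) (e y : ℝ) (d : Fin n → ℝ) (k : Fin n) : ℝ :=
  -(e * (dbump j k₁ d k * psi (rad n) y + bump j k₁ d * (dpsi (rad n) y * wt k₁ k)))

lemma hasDerivAt_bump {a : ℝ → Fin n → ℝ} {a' : Fin n → ℝ} {s : ℝ}
    (ha : ∀ k ≠ j, HasDerivAt (fun x => a x k) (a' k) s) :
    HasDerivAt (fun x => bump j k₁ (a x))
      (∑ k ∈ Finset.univ.erase j, dbump j k₁ (a s) k * a' k) s := by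
  have h1 : HasDerivAt (fun x => sqSum j k₁ (a x))
      (∑ k ∈ (Finset.univ.erase j).erase k₁, 2 * a s k * a' k) s := by
    unfold sqSum
    refine HasDerivAt.fun_sum fun k hk => ?_
    have hk' := Finset.ne_of_mem_erase (Finset.mem_of_mem_erase hk)
    exact ((ha k hk').fun_pow 2).congr_deriv (by simp)
  have h2 := (hasDerivAt_beta _).comp s (h1.div_const (rad n ^ 2))
  refine h2.congr_deriv ?_
  rw [← Finset.sum_erase (Finset.univ.erase j) (a := k₁) (by simp [dbump]),
    Finset.sum_div, Finset.mul_sum]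
  refine Finset.sum_congr rfl fun k hk => ?_
  rw [dbump, if_neg (Finset.ne_of_mem_erase hk)]
  ring

lemma hasDerivAt_sub_prof {h : ℝ → ℝ} {h' e : ℝ} {a : ℝ → Fin n → ℝ} {a' : Fin n → ℝ} {s : ℝ}
    (hh : HasDerivAt h h' s) (ha : ∀ k ≠ j, HasDerivAt (fun x => a x k) (a' k) s) :
    HasDerivAt (fun x => h x - prof j k₁ e (lin j k₁ (a x) + e * h x) (a x))
      (slopeH j k₁ e (lin j k₁ (a s) + e * h s) (a s) * h' +
        ∑ k ∈ Finset.univ.erase j, slope j k₁ e (lin j k₁ (a s) + e * h s) (a s) k * a' k) s := by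
  have h1 := hasDerivAt_bump (k₁ := k₁) ha
  have h2 : HasDerivAt (fun x => lin j k₁ (a x))
      (∑ k ∈ Finset.univ.erase j, wt k₁ k * a' k) s := by
    unfold lin
    exact HasDerivAt.fun_sum fun k hk => (ha k (Finset.ne_of_mem_erase hk)).const_mul _
  have h3 := (hasDerivAt_psi (rad n) (lin j k₁ (a s) + e * h s)).comp s (h2.fun_add (hh.const_mul e))
  refine (hh.fun_sub ((h1.const_mul e).fun_mul h3)).congr_deriv ?_
  have h4 : ∑ k ∈ Finset.univ.erase j, slope j k₁ e (lin j k₁ (a s) + e * h s) (a s) k * a' k =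
      -(e * ((∑ k ∈ Finset.univ.erase j, dbump j k₁ (a s) k * a' k) *
        psi (rad n) (lin j k₁ (a s) + e * h s) + bump j k₁ (a s) *
        (dpsi (rad n) (lin j k₁ (a s) + e * h s) *
          ∑ k ∈ Finset.univ.erase j, wt k₁ k * a' k))) := by
    rw [Finset.sum_mul, Finset.mul_sum, Finset.mul_sum, ← Finset.sum_add_distrib, Finset.mul_sum,
      ← Finset.sum_neg_distrib]
    refine Finset.sum_congr rfl fun k _ => ?_
    rw [slope]
    ring
  rw [h4, slopeH]
  simp only [Function.comp_apply]
  ring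

lemma slopeH_eq_zero {e y : ℝ} {d : Fin n → ℝ} (he : e ^ 2 ≤ 1)
    (h : slopeH j k₁ e y d = 0) :
    e ^ 2 = 1 ∧ bump j k₁ d = 1 ∧ y = 0 ∧ ∀ k ≠ j, k ≠ k₁ → d k = 0 := by
  have hb0 := bump_nonneg (j := j) (k₁ := k₁) d
  have hb1 := bump_le_one (j := j) (k₁ := k₁) d
  have hp := dpsi_le_one (rad n) y
  have he0 := sq_nonneg e
  have hr := rad_pos j
  rw [slopeH] at h
  have hx1 : e ^ 2 * bump j k₁ d ≤ 1 := by nlinarith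
  have hx0 : 0 ≤ e ^ 2 * bump j k₁ d := by positivity
  have h3 : e ^ 2 * bump j k₁ d = 1 := by
    by_contra hne
    have : e ^ 2 * bump j k₁ d < 1 := lt_of_le_of_ne hx1 hne
    nlinarith
  have h4 : dpsi (rad n) y = 1 := by rw [h3] at h; linarith
  have h5 : bump j k₁ d = 1 := by nlinarith
  refine ⟨by rw [h5] at h3; linarith, h5, eq_zero_of_dpsi_eq_one hr h4, fun k hk hk' => ?_⟩
  have h6 := eq_zero_of_beta_eq_one (div_nonneg (sqSum_nonneg d) (by positivity)) h5
  have h7 : sqSum j k₁ d = 0 := by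
    rcases div_eq_zero_iff.1 h6 with h | h
    · exact h
    · exact absurd h (by positivity)
  rw [sqSum, Finset.sum_eq_zero_iff_of_nonneg fun _ _ => sq_nonneg _] at h7
  exact pow_eq_zero_iff two_ne_zero |>.1 (h7 k (by simp [hk, hk']))

lemma bump_eq_one {d : Fin n → ℝ} (hd : ∀ k ≠ j, d k = 0) : bump j k₁ d = 1 := by
  rw [bump, sqSum, Finset.sum_eq_zero fun k hk => ?_, zero_div, beta_zero]
  rw [hd k (Finset.ne_of_mem_erase (Finset.mem_of_mem_erase hk))]
  simp

lemma slope_zero {e : ℝ} {d : Fin n → ℝ} (hb : bump j k₁ d = 1) (k : Fin n) :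
    slope j k₁ e 0 d k = -(e * wt k₁ k) := by
  rw [slope, psi_zero, dpsi_zero, hb]
  ring

lemma slopeH_zero {e : ℝ} {d : Fin n → ℝ} (hb : bump j k₁ d = 1) :
    slopeH j k₁ e 0 d = 1 - e ^ 2 := by
  rw [slopeH, dpsi_zero, hb]
  ring

lemma level_chart {t h : ℝ} {u : Fin n → ℂ} (hp : 0 < axisSq j h u)
    (ht : |freq j * t| < Real.pi / 2) : level j k₁ (chart j t h u) =
      h - prof j k₁ (eta t) (lin j k₁ (action u) + eta t * h) (action u) := by
  have ha : ∀ k ≠ j, action (trans j (chart j t h u)) k = action u k := fun k hk => by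
    rw [action, action, trans_chart hp ht hk]
  rw [level, energy_chart hp.le, flowTime_chart hp ht, lin_congr ha, prof, prof,
    bump_congr fun k hk _ => ha k hk]

lemma hasDerivAt_axisSq {h : ℝ → ℝ} {u : ℝ → Fin n → ℂ} {h' : ℝ} {u' : Fin n → ℂ}
    {s : ℝ} (hh : HasDerivAt h h' s) (hu : ∀ k ≠ j, HasDerivAt (fun x => u x k) (u' k) s) :
    HasDerivAt (fun x => axisSq j (h x) (u x))
      (h' - ∑ k ∈ Finset.univ.erase j, freq k * (conj (u s k - 1) * u' k).re) s := by
  unfold axisSq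
  refine (hh.const_add _).sub (HasDerivAt.fun_sum fun k hk => ?_)
  exact (((hasDerivAt_normSq ((hu k (Finset.ne_of_mem_erase hk)).sub_const 1)).const_mul
    (freq k)).div_const 2).congr_deriv (by ring)

/-- The value of the defining function at a point, as a function of `energy` and `action`. -/
noncomputable def levelArg (j k₁ : Fin n) (z : EuclideanSpace ℂ (Fin n)) : ℝ :=
  lin j k₁ (action (trans j z)) + eta (flowTime j z) * energy z

lemma exists_isChartVelocity_fderiv_level {z : EuclideanSpace ℂ (Fin n)} (hz : z ∈ dom j)
    (he : -1 ≤ energy z) (h' : ℝ) (u' : Fin n → ℂ) :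
    ∃ V, IsChartVelocity j (flowTime j z) (energy z) (trans j z) 0 h' u' V ∧
      fderiv ℝ (level j k₁) z V =
        slopeH j k₁ (eta (flowTime j z)) (levelArg j k₁ z) (action (trans j z)) * h' +
        ∑ k ∈ Finset.univ.erase j,
          slope j k₁ (eta (flowTime j z)) (levelArg j k₁ z) (action (trans j z)) k *
            (conj (trans j z k) * u' k).re := by
  set t := flowTime j z
  have hp := axisSq_pos he hz.2
  have ht : |freq j * t| < Real.pi / 2 := abs_freq_mul_flowTime_lt hz.1
  have hh : HasDerivAt (fun x : ℝ => energy z + x * h') h' 0 := by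
    simpa using ((hasDerivAt_id (0 : ℝ)).mul_const h').const_add (energy z)
  have hu : ∀ k, HasDerivAt (fun x : ℝ => trans j z k + x * u' k) (u' k) 0 := fun k => by
    simpa using ((hasDerivAt_id (0 : ℝ)).ofReal_comp.mul_const (u' k)).const_add (trans j z k)
  obtain ⟨V, hV, hV'⟩ := exists_isChartVelocity (j := j) (hasDerivAt_const (0 : ℝ) t) hh
    (u := fun x k => trans j z k + x * u' k) (fun k _ => hu k) (by simpa using hp)
  simp only [zero_mul, add_zero, Complex.ofReal_zero] at hV'
  refine ⟨V, hV', ?_⟩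
  have hc : chart j t (energy z + 0 * h') (fun k => trans j z k + ((0 : ℝ) : ℂ) * u' k) = z := by
    simp only [zero_mul, add_zero, Complex.ofReal_zero]
    exact chart_trans j z
  have h1 : HasDerivAt (fun x : ℝ => level j k₁
      (chart j t (energy z + x * h') fun k => trans j z k + x * u' k))
      (fderiv ℝ (level j k₁) z V) 0 := by
    refine HasFDerivAt.comp_hasDerivAt (0 : ℝ) (l := level j k₁) ?_ hV
    rw [hc]
    exact ((contDiffAt_level (m := 1) hz.1).differentiableAt (by simp)).hasFDerivAt
  have h2 := hasDerivAt_sub_prof (j := j) (k₁ := k₁) (e := eta t) hh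
    (a := fun x => action fun k => trans j z k + (x : ℂ) * u' k)
    (fun k _ => hasDerivAt_action (u := fun x k => trans j z k + (x : ℂ) * u' k) (hu k))
  simp only [zero_mul, add_zero, Complex.ofReal_zero] at h2
  have hev : ∀ᶠ x : ℝ in 𝓝 0,
      0 < axisSq j (energy z + x * h') fun k => trans j z k + (x : ℂ) * u' k :=
    continuousAt_const.eventually_lt (hasDerivAt_axisSq (j := j) hh
      (u := fun x k => trans j z k + (x : ℂ) * u' k) (fun k _ => hu k)).continuousAt
      (by simpa using hp)
  exact h1.unique (h2.congr_of_eventuallyEq (hev.mono fun x hx => level_chart hx ht))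

lemma fderiv_level_ne_zero (h1 : k₁ ≠ j) {z : EuclideanSpace ℂ (Fin n)} (hz : z ∈ dom j)
    (he : -1 ≤ energy z) : fderiv ℝ (level j k₁) z ≠ 0 := by
  intro h0
  obtain ⟨V, -, hV⟩ := exists_isChartVelocity_fderiv_level (k₁ := k₁) hz he 1 0
  rw [h0] at hV
  simp only [zero_apply, Pi.zero_apply, mul_zero, Complex.zero_re, Finset.sum_const_zero, add_zero,
    mul_one] at hV
  obtain ⟨hη, hb, hy, -⟩ := slopeH_eq_zero (eta_sq_le _) hV.symm
  obtain ⟨W, -, hW⟩ := exists_isChartVelocity_fderiv_level (k₁ := k₁) hz he 0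
    (Pi.single k₁ (trans j z k₁))
  rw [h0, hy, Finset.sum_eq_single_of_mem k₁ (by simp [h1]) fun k _ hk => by simp [hk],
    slope_zero hb] at hW
  simp only [zero_apply, mul_zero, zero_add, Pi.single_eq_same, wt, if_true, mul_one,
    ← Complex.normSq_eq_conj_mul_self, Complex.ofReal_re] at hW
  have h3 := normSq_trans_pos h1 hz
  have h4 : eta (flowTime j z) = 0 := by
    rcases mul_eq_zero.1 hW.symm with h | h
    · linarith
    · exact absurd h h3.ne'
  rw [h4] at hη
  norm_num at hη

/-- The velocity, in flow-box coordinates, of a curve following the Hamiltonian direction of the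
defining function. -/
lemma velocity_of_mem_dom {γ : ℝ → EuclideanSpace ℂ (Fin n)} {w : EuclideanSpace ℂ (Fin n)}
    {τ c : ℝ} (hγ : HasDerivAt γ w τ) (hz : γ τ ∈ dom j) (he : -1 ≤ energy (γ τ))
    (hc : ∀ v, stdSymp n w v = c * fderiv ℝ (level j k₁) (γ τ) v) :
    HasDerivAt (fun s => flowTime j (γ s))
      (-(c * slopeH j k₁ (eta (flowTime j (γ τ))) (levelArg j k₁ (γ τ))
        (action (trans j (γ τ))))) τ ∧
    ∀ k ≠ j, HasDerivAt (fun s => trans j (γ s) k)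
      (-((c * slope j k₁ (eta (flowTime j (γ τ))) (levelArg j k₁ (γ τ))
        (action (trans j (γ τ))) k : ℝ) : ℂ) * Complex.I * trans j (γ τ) k) τ := by
  have ht := ((contDiffAt_flowTime (m := 1) hz.1).differentiableAt
    (by simp)).hasFDerivAt.comp_hasDerivAt τ hγ
  have hh := ((contDiff_energy (m := 1)).contDiffAt.differentiableAt
    (by simp)).hasFDerivAt.comp_hasDerivAt τ hγ
  have hu := fun k => ((contDiffAt_trans (k := k) (m := 1) hz.1).differentiableAt
    (by simp)).hasFDerivAt.comp_hasDerivAt τ hγ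
  have hp := axisSq_pos he hz.2
  obtain ⟨V, hV, hV'⟩ := exists_isChartVelocity (j := j) ht hh (u := fun s => trans j (γ s))
    (u' := fun k => fderiv ℝ (fun z => trans j z k) (γ τ) w) (fun k _ => hu k) hp
  have hVw : V = w := by
    refine hV.unique (hγ.congr_of_eventuallyEq (Eventually.of_forall fun s => ?_))
    exact chart_trans j (γ s)
  rw [hVw] at hV'
  constructor
  · refine ht.congr_deriv ?_
    obtain ⟨W, hW, hW'⟩ := exists_isChartVelocity_fderiv_level (k₁ := k₁) hz he 1 0
    have h1 := stdSymp_of_isChartVelocity hV' hW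
    rw [hc, hW'] at h1
    simp at h1
    linarith
  · intro k hk
    refine (hu k).congr_deriv ?_
    refine (eq_neg_I_mul_of_im_conj_mul fun v => ?_)
    obtain ⟨W, hW, hW'⟩ := exists_isChartVelocity_fderiv_level (k₁ := k₁) hz he 0 (Pi.single k v)
    have h1 := stdSymp_of_isChartVelocity hV' hW
    rw [hc, hW', Finset.sum_eq_single_of_mem k (by simp [hk]) fun l _ hl => by simp [hl],
      Finset.sum_eq_single_of_mem k (by simp [hk]) fun l _ hl => by simp [hl]] at h1
    simp only [mul_zero, zero_mul, add_zero, zero_add, sub_zero, Pi.single_eq_same] at h1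
    rw [← h1]
    ring

lemma fderiv_energy_apply (z v : EuclideanSpace ℂ (Fin n)) :
    fderiv ℝ energy z v = ∑ k, freq k * (conj (z k) * v k).re := by
  have hl : ∀ k, HasDerivAt (fun x : ℝ => z k + x * v k) (v k) 0 := fun k => by
    simpa using ((hasDerivAt_id (0 : ℝ)).ofReal_comp.mul_const (v k)).const_add (z k)
  have h1 : HasDerivAt (fun x : ℝ => energy (z + x • v))
      (∑ k, freq k * (conj (z k) * v k).re) 0 := by
    unfold energy
    refine (HasDerivAt.fun_sum fun k _ => ?_).sub_const _
    have := ((hasDerivAt_normSq (hl k)).const_mul (freq k)).div_const 2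
    simp only [Complex.ofReal_zero, zero_mul, add_zero] at this
    refine (this.congr_deriv (by ring)).congr_of_eventuallyEq (Eventually.of_forall fun x => ?_)
    simp
  have h2 : HasDerivAt (fun x : ℝ => z + x • v) v 0 := by
    simpa using ((hasDerivAt_id (0 : ℝ)).smul_const v).const_add z
  have h3 : HasFDerivAt energy (fderiv ℝ energy z) (z + (0 : ℝ) • v) := by
    rw [zero_smul, add_zero]
    exact ((contDiff_energy (m := 1)).contDiffAt.differentiableAt (by simp)).hasFDerivAt
  exact (HasFDerivAt.comp_hasDerivAt (l := energy) (0 : ℝ) h3 h2).unique h1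

/-- The velocity of a curve following the Hamiltonian direction of the energy. -/
lemma velocity_of_energy {z w : EuclideanSpace ℂ (Fin n)} {c : ℝ}
    (hc : ∀ v, stdSymp n w v = c * fderiv ℝ energy z v) (k : Fin n) :
    w k = -((c * freq k : ℝ) : ℂ) * Complex.I * z k := by
  refine eq_neg_I_mul_of_im_conj_mul fun v => ?_
  rw [← stdSymp_toLp_single, hc, fderiv_energy_apply, Finset.sum_eq_single k]
  · simp
    ring
  · intro l _ hl
    simp [hl]
  · simp

lemma fderiv_energy_ne_zero {z : EuclideanSpace ℂ (Fin n)} (hz : energy z = 0) (hn : 3 ≤ n) :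
    fderiv ℝ energy z ≠ 0 := by
  intro h0
  have h1 := fderiv_energy_apply z z
  have h2 : ∑ k, freq k * (conj (z k) * z k).re = 2 * (energy z + 10 * n) := by
    rw [energy, sub_add_cancel, Finset.mul_sum]
    refine Finset.sum_congr rfl fun k _ => ?_
    rw [← Complex.normSq_eq_conj_mul_self, Complex.ofReal_re]
    ring
  have hn' : (3 : ℝ) ≤ n := by exact_mod_cast hn
  rw [h0, h2, hz] at h1
  simp at h1
  omega

end HamiltonianSeifert

namespace HamiltonianSeifert

open Filter Topology Set
open scoped ContDiff RealInnerProductSpace ComplexConjugate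

/-! ### Periodic solutions of linear phase equations -/

lemma eq_mul_exp_of_hasDerivAt {p : ℝ → ℂ} {ν : ℝ → ℝ} {α : ℝ} (hν : Continuous ν)
    (hp : ∀ t, HasDerivAt p (((α * ν t : ℝ) : ℂ) * Complex.I * p t) t) (t : ℝ) :
    p t = p 0 * Complex.exp ((α * ∫ s in (0 : ℝ)..t, ν s : ℝ) * Complex.I) := by
  have hN : ∀ t, HasDerivAt (fun t => ∫ s in (0 : ℝ)..t, ν s) (ν t) t := fun t =>
    intervalIntegral.integral_hasDerivAt_right (hν.intervalIntegrable _ _)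
      (hν.stronglyMeasurableAtFilter _ _) hν.continuousAt
  have hd : ∀ t, HasDerivAt
      (fun t => p t * Complex.exp (-((α * ∫ s in (0 : ℝ)..t, ν s : ℝ) * Complex.I))) 0 t := by
    intro t
    have h1 := (((hN t).const_mul α).ofReal_comp.mul_const Complex.I).neg.cexp
    refine ((hp t).fun_mul h1).congr_deriv ?_
    simp only [Pi.neg_apply]
    push_cast
    ring
  have h2 := is_const_of_deriv_eq_zero (fun t => (hd t).differentiableAt)
    (fun t => (hd t).deriv) t 0
  simp only [intervalIntegral.integral_same, mul_zero, Complex.ofReal_zero, zero_mul, neg_zero,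
    Complex.exp_zero, mul_one] at h2
  rw [← h2, mul_assoc, ← Complex.exp_add, neg_add_cancel, Complex.exp_zero, mul_one]

lemma integral_ne_zero_of_ne_zero {ν : ℝ → ℝ} {T : ℝ} (hν : Continuous ν) (h0 : ∀ t, ν t ≠ 0)
    (hT : 0 < T) : ∫ s in (0 : ℝ)..T, ν s ≠ 0 := by
  by_cases h : 0 < ν 0
  · have hpos : ∀ t, 0 < ν t := fun t => by
      by_contra hn
      obtain ⟨s, hs⟩ := mem_range_of_exists_le_of_exists_ge hν ⟨t, not_lt.1 hn⟩ ⟨0, h.le⟩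
      exact h0 s hs
    exact (intervalIntegral.intervalIntegral_pos_of_pos (hν.intervalIntegrable _ _) hpos hT).ne'
  · have hneg : ∀ t, 0 < -ν t := fun t => by
      by_contra hn
      obtain ⟨s, hs⟩ := mem_range_of_exists_le_of_exists_ge hν ⟨0, not_lt.1 h⟩
        ⟨t, by linarith⟩
      exact h0 s hs
    have := intervalIntegral.intervalIntegral_pos_of_pos (hν.neg.intervalIntegrable _ _) hneg hT
    have h2 : ∫ s in (0 : ℝ)..T, (-ν) s = -∫ s in (0 : ℝ)..T, ν s := intervalIntegral.integral_neg
    rw [h2] at this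
    linarith

/-- The phase gained over a period is a nonzero multiple of `2π`. -/
lemma exists_int_of_periodic {p : ℝ → ℂ} {ν : ℝ → ℝ} {α T : ℝ} (hν : Continuous ν)
    (h0 : ∀ t, ν t ≠ 0) (hT : 0 < T) (hα : α ≠ 0)
    (hp : ∀ t, HasDerivAt p (((α * ν t : ℝ) : ℂ) * Complex.I * p t) t) (hp0 : p 0 ≠ 0)
    (hpT : p T = p 0) :
    ∃ m : ℤ, m ≠ 0 ∧ α * ∫ s in (0 : ℝ)..T, ν s = m * (2 * Real.pi) := by
  have h1 := eq_mul_exp_of_hasDerivAt hν hp T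
  rw [hpT] at h1
  obtain ⟨m, hm⟩ := Complex.exp_eq_one_iff.1 (mul_left_cancel₀ hp0 (by rw [← h1, mul_one]))
  have h2 : α * ∫ s in (0 : ℝ)..T, ν s = m * (2 * Real.pi) := by
    rw [← mul_assoc, ← mul_assoc] at hm
    have := mul_right_cancel₀ Complex.I_ne_zero hm
    rw [← mul_assoc]
    exact_mod_cast this
  refine ⟨m, ?_, h2⟩
  rintro rfl
  have h3 := integral_ne_zero_of_ne_zero hν h0 hT
  simp [hα, h3] at h2

lemma exists_int_mul_eq_of_periodic {p q : ℝ → ℂ} {ν : ℝ → ℝ} {α β T : ℝ} (hν : Continuous ν)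
    (h0 : ∀ t, ν t ≠ 0) (hT : 0 < T) (hα : α ≠ 0) (hβ : β ≠ 0)
    (hp : ∀ t, HasDerivAt p (((α * ν t : ℝ) : ℂ) * Complex.I * p t) t) (hp0 : p 0 ≠ 0)
    (hpT : p T = p 0)
    (hq : ∀ t, HasDerivAt q (((β * ν t : ℝ) : ℂ) * Complex.I * q t) t) (hq0 : q 0 ≠ 0)
    (hqT : q T = q 0) :
    ∃ a b : ℤ, a ≠ 0 ∧ b ≠ 0 ∧ α * a = β * b := by
  obtain ⟨m, hm, h1⟩ := exists_int_of_periodic hν h0 hT hα hp hp0 hpT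
  obtain ⟨l, hl, h2⟩ := exists_int_of_periodic hν h0 hT hβ hq hq0 hqT
  refine ⟨l, m, hl, hm, ?_⟩
  have h3 := integral_ne_zero_of_ne_zero hν h0 hT
  have h4 : (α * l - β * m) * (2 * Real.pi) = 0 := by
    have : α * (l * (2 * Real.pi)) = β * (m * (2 * Real.pi)) := by
      rw [← h1, ← h2]
      ring
    linarith
  have h5 := (mul_eq_zero.1 h4).resolve_right (by positivity)
  linarith

lemma exists_eq_norm_of_periodic {p : ℝ → ℂ} {ν : ℝ → ℝ} {α T : ℝ} (hν : Continuous ν)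
    (h0 : ∀ t, ν t ≠ 0) (hT : 0 < T) (hα : α ≠ 0)
    (hp : ∀ t, HasDerivAt p (((α * ν t : ℝ) : ℂ) * Complex.I * p t) t) (hp0 : p 0 ≠ 0)
    (hpT : p T = p 0) : ∃ t, p t = ‖p 0‖ := by
  obtain ⟨m, hm, h1⟩ := exists_int_of_periodic hν h0 hT hα hp hp0 hpT
  set N : ℝ → ℝ := fun t => α * ∫ s in (0 : ℝ)..t, ν s with hN
  have hNc : Continuous N :=
    continuous_const.mul (intervalIntegral.continuous_primitive (fun a b => hν.intervalIntegrable a b) 0)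
  have hN0 : N 0 = 0 := by simp [hN]
  have hNT : N T = m * (2 * Real.pi) := h1
  have hsub := intermediate_value_uIcc (a := 0) (b := T) hNc.continuousOn
  rw [hN0, hNT] at hsub
  have hpi := Real.pi_pos
  have ha := Complex.neg_pi_lt_arg (p 0)
  have ha' := Complex.arg_le_pi (p 0)
  obtain ⟨b, hb⟩ : ∃ b : ℤ, b * (2 * Real.pi) - (p 0).arg ∈ uIcc 0 (m * (2 * Real.pi)) := by
    rcases lt_or_gt_of_ne hm with hm | hm
    · have : (m : ℝ) ≤ -1 := by exact_mod_cast Int.le_sub_one_of_lt hm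
      have h2 : m * (2 * Real.pi) ≤ -(2 * Real.pi) := by nlinarith
      by_cases h : 0 ≤ (p 0).arg
      · refine ⟨0, ?_⟩
        rw [uIcc_of_ge (by linarith)]
        constructor <;> push_cast <;> linarith
      · refine ⟨-1, ?_⟩
        rw [uIcc_of_ge (by linarith)]
        constructor <;> push_cast <;> linarith
    · have : (1 : ℝ) ≤ m := by exact_mod_cast hm
      have h2 : 2 * Real.pi ≤ m * (2 * Real.pi) := by nlinarith
      by_cases h : (p 0).arg ≤ 0
      · refine ⟨0, ?_⟩
        rw [uIcc_of_le (by linarith)]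
        constructor <;> push_cast <;> linarith
      · refine ⟨1, ?_⟩
        rw [uIcc_of_le (by linarith)]
        constructor <;> push_cast <;> linarith
  obtain ⟨t, -, ht⟩ := hsub hb
  refine ⟨t, ?_⟩
  rw [eq_mul_exp_of_hasDerivAt hν hp t]
  change p 0 * Complex.exp ((N t : ℝ) * Complex.I) = _
  rw [ht]
  nth_rw 1 [← Complex.norm_mul_exp_arg_mul_I (p 0)]
  rw [mul_assoc, ← Complex.exp_add]
  have : ((p 0).arg : ℂ) * Complex.I + ((b * (2 * Real.pi) - (p 0).arg : ℝ) : ℂ) * Complex.I =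
      b * (2 * Real.pi * Complex.I) := by
    push_cast
    ring
  rw [this, Complex.exp_int_mul_two_pi_mul_I, mul_one]

/-! ### Real functions -/

lemma eq_of_monotone_of_periodic {f : ℝ → ℝ} {T : ℝ} (hf : Monotone f) (hT : 0 < T)
    (hp : ∀ t, f (t + T) = f t) (x y : ℝ) : f x = f y := by
  have key : ∀ x y, f y ≤ f x := by
    intro x y
    obtain ⟨N, hN⟩ := exists_nat_ge ((y - x) / T)
    have h1 : Function.Periodic f (N * T) := Function.Periodic.nat_mul hp N
    rw [← h1 x]
    refine hf ?_
    rw [div_le_iff₀ hT] at hN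
    linarith
  exact le_antisymm (key y x) (key x y)

/-- A periodic function whose derivative is a nonvanishing continuous function times a
nonnegative one is constant. -/
lemma deriv_eq_zero_of_periodic {f c w : ℝ → ℝ} {T : ℝ} (hT : 0 < T)
    (hp : ∀ t, f (t + T) = f t) (hf : ∀ t, HasDerivAt f (c t * w t) t) (hc : Continuous c)
    (hc0 : ∀ t, c t ≠ 0) (hw : ∀ t, 0 ≤ w t) (t : ℝ) : c t * w t = 0 := by
  have hconst : ∀ x y, f x = f y := by
    by_cases h : 0 < c 0
    · have hpos : ∀ t, 0 ≤ c t := fun t => by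
        by_contra! hn
        obtain ⟨s, hs⟩ := mem_range_of_exists_le_of_exists_ge hc ⟨t, hn.le⟩ ⟨0, h.le⟩
        exact hc0 s hs
      exact eq_of_monotone_of_periodic (monotone_of_hasDerivAt_nonneg hf
        fun t => mul_nonneg (hpos t) (hw t)) hT hp
    · have hneg : ∀ t, c t ≤ 0 := fun t => by
        by_contra! hn
        obtain ⟨s, hs⟩ := mem_range_of_exists_le_of_exists_ge hc ⟨0, not_lt.1 h⟩ ⟨t, hn.le⟩
        exact hc0 s hs
      have h1 := eq_of_monotone_of_periodic (f := fun t => -f t)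
        (monotone_of_hasDerivAt_nonneg (fun t => (hf t).neg)
        fun t => by have := mul_nonpos_of_nonpos_of_nonneg (hneg t) (hw t); simpa using this) hT
        (fun t => by rw [hp])
      intro x y
      simpa using h1 x y
  have h1 : f = fun _ => f 0 := funext fun x => hconst x 0
  have h2 := hf t
  rw [h1] at h2
  exact h2.unique (hasDerivAt_const t (f 0))

/-- An equilibrium of a scalar equation with locally Lipschitz right-hand side is isolated in
time from other solutions. -/
lemma eventually_eq_of_hasDerivAt {f c w : ℝ → ℝ} {t₀ : ℝ} {τ₀ : ℝ} (hw : ContDiff ℝ 1 w)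
    (hw0 : w t₀ = 0) (hc : ContinuousAt c τ₀) (hf : ∀ᶠ τ in 𝓝 τ₀, HasDerivAt f (c τ * w (f τ)) τ)
    (hf0 : f τ₀ = t₀) : ∀ᶠ τ in 𝓝 τ₀, f τ = t₀ := by
  obtain ⟨K, U, hU, hK⟩ := hw.contDiffAt.exists_lipschitzOnWith (x := t₀)
  have hfc : ContinuousAt f τ₀ := hf.self_of_nhds.continuousAt
  have hMc : ∀ᶠ τ in 𝓝 τ₀, |c τ| < |c τ₀| + 1 :=
    hc.abs.eventually_lt continuousAt_const (by linarith)
  have hUf : ∀ᶠ τ in 𝓝 τ₀, f τ ∈ U := hfc (by rwa [hf0])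
  obtain ⟨ε, hε, hball⟩ := Metric.eventually_nhds_iff_ball.1 (hf.and (hMc.and hUf))
  have hbound : ∀ τ ∈ Metric.ball τ₀ ε,
      |c τ * w (f τ)| ≤ (|c τ₀| + 1) * K * |f τ - t₀| := by
    intro τ hτ
    obtain ⟨-, h2, h3⟩ := hball τ hτ
    have h4 := hK.dist_le_mul _ h3 _ (mem_of_mem_nhds hU)
    rw [hw0, Real.dist_eq, Real.dist_eq, sub_zero] at h4
    rw [abs_mul, mul_assoc]
    exact mul_le_mul h2.le h4 (abs_nonneg _) (by positivity)
  have right : ∀ b, 0 ≤ b → b < ε → f (τ₀ + b) = t₀ := by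
    intro b hb0 hb
    have hmem : ∀ x ∈ Icc τ₀ (τ₀ + b), x ∈ Metric.ball τ₀ ε := fun x hx => by
      rw [Metric.mem_ball, Real.dist_eq, abs_lt]
      constructor <;> linarith [hx.1, hx.2]
    have := eq_zero_of_abs_deriv_le_mul_abs_self_of_eq_zero_right (f := fun x => f x - t₀)
      (f' := fun τ => c τ * w (f τ)) (K := (|c τ₀| + 1) * K) (a := τ₀) (b := τ₀ + b)
      (fun x hx => ((hball x (hmem x hx)).1.sub_const t₀).continuousAt.continuousWithinAt)
      (fun x hx => ((hball x (hmem x (Ico_subset_Icc_self hx))).1.sub_const t₀).hasDerivWithinAt)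
      (by simp [hf0]) (fun x hx => hbound x (hmem x (Ico_subset_Icc_self hx)))
      (τ₀ + b) ⟨by linarith, le_rfl⟩
    exact sub_eq_zero.1 this
  have left : ∀ b, 0 ≤ b → b < ε → f (τ₀ - b) = t₀ := by
    intro b hb0 hb
    have hmem : ∀ x ∈ Icc (0 : ℝ) b, τ₀ - x ∈ Metric.ball τ₀ ε := fun x hx => by
      rw [Metric.mem_ball, Real.dist_eq, abs_lt]
      constructor <;> linarith [hx.1, hx.2]
    have hd : ∀ x ∈ Icc (0 : ℝ) b, HasDerivAt (fun x => f (τ₀ - x) - t₀)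
        (-(c (τ₀ - x) * w (f (τ₀ - x)))) x := fun x hx => by
      have := ((hball _ (hmem x hx)).1.comp x ((hasDerivAt_id x).const_sub τ₀)).sub_const t₀
      simpa using this
    have := eq_zero_of_abs_deriv_le_mul_abs_self_of_eq_zero_right (f := fun x => f (τ₀ - x) - t₀)
      (f' := fun x => -(c (τ₀ - x) * w (f (τ₀ - x)))) (K := (|c τ₀| + 1) * K) (a := 0) (b := b)
      (fun x hx => (hd x hx).continuousAt.continuousWithinAt)
      (fun x hx => (hd x (Ico_subset_Icc_self hx)).hasDerivWithinAt)
      (by simp [hf0]) (fun x hx => by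
        rw [norm_neg]
        exact hbound _ (hmem x (Ico_subset_Icc_self hx)))
      b ⟨hb0, le_rfl⟩
    exact sub_eq_zero.1 this
  filter_upwards [Metric.ball_mem_nhds τ₀ hε] with τ hτ
  rw [Metric.mem_ball, Real.dist_eq, abs_lt] at hτ
  rcases le_total τ₀ τ with h | h
  · have := right (τ - τ₀) (by linarith) (by linarith)
    simpa using this
  · have := left (τ₀ - τ) (by linarith) (by linarith)
    simpa using this

lemma eventually_eq_of_eventually_hasDerivAt_zero {E : Type*} [NormedAddCommGroup E]
    [NormedSpace ℝ E] {f : ℝ → E} {τ₀ : ℝ} (hf : ∀ᶠ τ in 𝓝 τ₀, HasDerivAt f 0 τ) :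
    ∀ᶠ τ in 𝓝 τ₀, f τ = f τ₀ := by
  obtain ⟨ε, hε, hball⟩ := Metric.eventually_nhds_iff_ball.1 hf
  filter_upwards [Metric.ball_mem_nhds τ₀ hε] with τ hτ
  exact Metric.isOpen_ball.is_const_of_deriv_eq_zero (convex_ball τ₀ ε).isPreconnected
    (fun x hx => (hball x hx).differentiableAt.differentiableWithinAt)
    (fun x hx => (hball x hx).deriv) hτ (Metric.mem_ball_self hε)

/-! ### Primitives of odd functions -/

lemma hasDerivAt_integral_neg_abs {m : ℝ → ℝ} {t₀ b : ℝ} (hodd : ∀ s, m (-s) = -m s)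
    (hz : ∀ s, |s| ≤ 1 / 4 → m s = 0) (hb : -1 < b) (hb' : -|t₀| < b)
    (hc : ContinuousOn m (Iio b)) :
    HasDerivAt (fun t => ∫ s in (-1 : ℝ)..(-|t|), m s) (m t₀) t₀ := by
  have hint : ∀ x y, x < b → y < b → IntervalIntegrable m MeasureTheory.volume x y := by
    intro x y hx hy
    exact (hc.mono fun s hs => lt_of_le_of_lt hs.2 (max_lt hx hy)).intervalIntegrable
  have hG : ∀ x < b, HasDerivAt (fun x => ∫ s in (-1 : ℝ)..x, m s) (m x) x := fun x hx =>
    intervalIntegral.integral_hasDerivAt_right (hint _ _ hb hx)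
      (hc.stronglyMeasurableAtFilter isOpen_Iio x hx) (hc.continuousAt (Iio_mem_nhds hx))
  rcases lt_trichotomy t₀ 0 with h | h | h
  · have h1 := hG t₀ (by rwa [abs_of_neg h, neg_neg] at hb')
    refine h1.congr_of_eventuallyEq ?_
    filter_upwards [Iio_mem_nhds h] with t ht
    rw [abs_of_neg ht, neg_neg]
  · subst h
    rw [abs_zero, neg_zero] at hb'
    rw [hz 0 (by norm_num)]
    refine (hasDerivAt_const (0 : ℝ) (∫ s in (-1 : ℝ)..0, m s)).congr_of_eventuallyEq ?_
    filter_upwards [Metric.ball_mem_nhds (0 : ℝ) (show (0 : ℝ) < 1 / 4 by norm_num)] with t ht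
    rw [mem_ball_zero_iff, Real.norm_eq_abs] at ht
    rw [← intervalIntegral.integral_add_adjacent_intervals (hint (-1) 0 hb hb')
      (hint 0 (-|t|) hb' (by linarith [abs_nonneg t]))]
    have h0 : ∫ s in (0 : ℝ)..(-|t|), m s = ∫ _ in (0 : ℝ)..(-|t|), (0 : ℝ) := by
      refine intervalIntegral.integral_congr fun s hs => ?_
      rw [uIcc_of_ge (by linarith [abs_nonneg t])] at hs
      exact hz s (abs_le.2 ⟨by linarith [hs.1], by linarith [hs.2]⟩)
    rw [h0]
    simp
  · have h1 := (hG (-t₀) (by rwa [abs_of_pos h] at hb')).comp t₀ (hasDerivAt_neg t₀)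
    rw [hodd, neg_mul_neg, mul_one] at h1
    refine h1.congr_of_eventuallyEq ?_
    filter_upwards [Ioi_mem_nhds h] with t ht
    simp only [Function.comp_apply]
    rw [abs_of_pos ht]

end HamiltonianSeifert

namespace HamiltonianSeifert

open Filter Topology Set
open scoped ContDiff RealInnerProductSpace ComplexConjugate

/-! ### Characteristics of the deformed ellipsoid -/

variable {n : ℕ} {j k₁ : Fin n} {κ : Fin n → Fin n} {γ : ℝ → EuclideanSpace ℂ (Fin n)} {τ T : ℝ}

/-- The properties of a parametrized characteristic which are used below. -/
structure IsCharacteristic (κ : Fin n → Fin n) (γ : ℝ → EuclideanSpace ℂ (Fin n)) : Prop where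
  smooth : ContDiff ℝ 1 γ
  energy_ge : ∀ τ, -1 ≤ energy (γ τ)
  level_eq : ∀ τ j, γ τ ∈ dom j → level j (κ j) (γ τ) = 0
  energy_eq : ∀ τ, (∀ j, γ τ ∉ dom j) → energy (γ τ) = 0
  level_dir : ∀ τ j, γ τ ∈ dom j → ∃ c : ℝ, c ≠ 0 ∧
    ∀ v, stdSymp n (deriv γ τ) v = c * fderiv ℝ (level j (κ j)) (γ τ) v
  energy_dir : ∀ τ, (∀ j, γ τ ∉ dom j) → ∃ c : ℝ, c ≠ 0 ∧
    ∀ v, stdSymp n (deriv γ τ) v = c * fderiv ℝ energy (γ τ) v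

namespace IsCharacteristic

lemma hasDerivAt (h : IsCharacteristic κ γ) (τ : ℝ) : HasDerivAt γ (deriv γ τ) τ :=
  (h.smooth.differentiable (by simp) τ).hasDerivAt

lemma eventually_mem_dom (h : IsCharacteristic κ γ) (hτ : γ τ ∈ dom j) :
    ∀ᶠ σ in 𝓝 τ, γ σ ∈ dom j :=
  h.smooth.continuous.continuousAt ((isOpen_dom j).mem_nhds hτ)

/-- The velocity in flow-box coordinates. -/
lemma exists_velocity (h : IsCharacteristic κ γ) (hτ : γ τ ∈ dom j) : ∃ c : ℝ, c ≠ 0 ∧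
    HasDerivAt (fun s => flowTime j (γ s))
      (-(c * slopeH j (κ j) (eta (flowTime j (γ τ))) (levelArg j (κ j) (γ τ))
        (action (trans j (γ τ))))) τ ∧
    ∀ k ≠ j, HasDerivAt (fun s => trans j (γ s) k)
      (-((c * slope j (κ j) (eta (flowTime j (γ τ))) (levelArg j (κ j) (γ τ))
        (action (trans j (γ τ))) k : ℝ) : ℂ) * Complex.I * trans j (γ τ) k) τ := by
  obtain ⟨c, hc0, hc⟩ := h.level_dir τ j hτ
  exact ⟨c, hc0, velocity_of_mem_dom (h.hasDerivAt τ) hτ (h.energy_ge τ) hc⟩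

lemma hasDerivAt_action (h : IsCharacteristic κ γ) (hτ : γ τ ∈ dom j) {k : Fin n} (hk : k ≠ j) :
    HasDerivAt (fun s => action (trans j (γ s)) k) 0 τ := by
  obtain ⟨c, -, -, hc⟩ := h.exists_velocity hτ
  have h1 := HamiltonianSeifert.hasDerivAt_action (u := fun s => trans j (γ s))
    (u' := fun _ => _) (hc k hk)
  refine h1.congr_deriv ?_
  simp
  ring

lemma eventually_action_eq (h : IsCharacteristic κ γ) (hτ : γ τ ∈ dom j) :
    ∀ᶠ σ in 𝓝 τ, ∀ k ≠ j, action (trans j (γ σ)) k = action (trans j (γ τ)) k := by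
  refine eventually_all.2 fun k => eventually_imp_distrib_left.2 fun hk => ?_
  exact eventually_eq_of_eventually_hasDerivAt_zero
    ((h.eventually_mem_dom hτ).mono fun σ hσ => h.hasDerivAt_action hσ hk)

lemma levelArg_sub (h : IsCharacteristic κ γ) (hτ : γ τ ∈ dom j) :
    levelArg j (κ j) (γ τ) - eta (flowTime j (γ τ)) ^ 2 * bump j (κ j) (action (trans j (γ τ))) *
      psi (rad n) (levelArg j (κ j) (γ τ)) = lin j (κ j) (action (trans j (γ τ))) := by
  have h1 := h.level_eq τ j hτ
  rw [level, ← levelArg, prof] at h1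
  nth_rw 1 [levelArg]
  linear_combination eta (flowTime j (γ τ)) * h1

lemma energy_eq_prof (h : IsCharacteristic κ γ) (hτ : γ τ ∈ dom j) :
    energy (γ τ) = prof j (κ j) (eta (flowTime j (γ τ))) (levelArg j (κ j) (γ τ))
      (action (trans j (γ τ))) :=
  sub_eq_zero.1 (h.level_eq τ j hτ)

lemma levelArg_eq_sol (h : IsCharacteristic κ γ) (hτ : γ τ ∈ dom j) :
    levelArg j (κ j) (γ τ) = sol (rad n)
      (eta (flowTime j (γ τ)) ^ 2 * bump j (κ j) (action (trans j (γ τ))))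
      (lin j (κ j) (action (trans j (γ τ)))) :=
  (sol_eq (rad_pos j) (mul_nonneg (sq_nonneg _) (bump_nonneg _))
    (mul_le_one₀ (eta_sq_le _) (bump_nonneg _) (bump_le_one _)) (h.levelArg_sub hτ)).symm

end IsCharacteristic

/-! ### Trapped characteristics -/

/-- The trapped set of the plug with axis `j`. -/
def trapped (j : Fin n) : Set (EuclideanSpace ℂ (Fin n)) :=
  {z | z ∈ dom j ∧ (∀ k ≠ j, action (trans j z) k = 0) ∧ |flowTime j z| ≤ 1 / 2}

lemma lin_eq_zero {d : Fin n → ℝ} (hd : ∀ k ≠ j, d k = 0) : lin j k₁ d = 0 :=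
  Finset.sum_eq_zero fun k hk => by rw [hd k (Finset.ne_of_mem_erase hk), mul_zero]

lemma continuousAt_deriv_of_contDiffAt {E : Type*} [NormedAddCommGroup E]
    [NormedSpace ℝ E] {f : ℝ → E} (hf : ContDiffAt ℝ 1 f τ) : ContinuousAt (deriv f) τ := by
  have h1 : ContinuousAt (fderiv ℝ f) τ := (hf.fderiv_right (m := 0) (by simp)).continuousAt
  have h2 : deriv f = fun t => fderiv ℝ f t 1 := funext fun t => fderiv_apply_one_eq_deriv.symm
  rw [h2]
  exact h1.clm_apply continuousAt_const

/-- The rate of rotation of the transverse coordinate of index `k₁`. -/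
noncomputable def spin (j k₁ : Fin n) (γ : ℝ → EuclideanSpace ℂ (Fin n)) (τ : ℝ) : ℝ :=
  (conj (trans j (γ τ) k₁) * deriv (fun s => trans j (γ s) k₁) τ).im

/-- The multiplier of a trapped characteristic. -/
noncomputable def rate (j k₁ : Fin n) (γ : ℝ → EuclideanSpace ℂ (Fin n)) (τ : ℝ) : ℝ :=
  -deriv (fun s => flowTime j (γ s)) τ + eta (flowTime j (γ τ)) * spin j k₁ γ τ

namespace IsCharacteristic

lemma continuousAt_spin (h : IsCharacteristic κ γ) (hτ : γ τ ∈ dom j) :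
    ContinuousAt (spin j k₁ γ) τ := by
  have h1 : ContDiffAt ℝ 1 (fun s => trans j (γ s) k₁) τ :=
    (contDiffAt_trans (m := 1) hτ.1).comp τ h.smooth.contDiffAt
  exact Complex.continuous_im.continuousAt.comp
    ((Complex.continuous_conj.continuousAt.comp h1.continuousAt).mul
      (continuousAt_deriv_of_contDiffAt h1))

lemma continuousAt_rate (h : IsCharacteristic κ γ) (hτ : γ τ ∈ dom j) :
    ContinuousAt (rate j k₁ γ) τ := by
  have h1 : ContDiffAt ℝ 1 (fun s => flowTime j (γ s)) τ :=
    (contDiffAt_flowTime (m := 1) hτ.1).comp τ h.smooth.contDiffAt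
  exact (continuousAt_deriv_of_contDiffAt h1).neg.add
    ((continuous_eta.continuousAt.comp h1.continuousAt).mul (h.continuousAt_spin hτ))

lemma velocity_of_action_eq_zero (h : IsCharacteristic κ γ) (hκ : κ j ≠ j) (hτ : γ τ ∈ dom j)
    (hd : ∀ k ≠ j, action (trans j (γ τ)) k = 0) :
    rate j (κ j) γ τ ≠ 0 ∧
    spin j (κ j) γ τ = rate j (κ j) γ τ * eta (flowTime j (γ τ)) ∧
    HasDerivAt (fun s => flowTime j (γ s))
      (-rate j (κ j) γ τ * (1 - eta (flowTime j (γ τ)) ^ 2)) τ ∧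
    ∀ k ≠ j, HasDerivAt (fun s => trans j (γ s) k)
      (((wt (κ j) k * spin j (κ j) γ τ : ℝ) : ℂ) * Complex.I * trans j (γ τ) k) τ := by
  obtain ⟨c, hc0, h1, h2⟩ := h.exists_velocity hτ
  have hb := bump_eq_one (k₁ := κ j) hd
  have hy : levelArg j (κ j) (γ τ) = 0 := by
    rw [h.levelArg_eq_sol hτ]
    refine sol_eq (rad_pos j) (mul_nonneg (sq_nonneg _) (bump_nonneg _))
      (mul_le_one₀ (eta_sq_le _) (bump_nonneg _) (bump_le_one _)) ?_
    rw [psi_zero, lin_eq_zero hd]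
    ring
  rw [hy, slopeH_zero hb] at h1
  simp only [hy, slope_zero hb] at h2
  have hn : Complex.normSq (trans j (γ τ) (κ j)) = 1 := by
    have := hd _ hκ
    rw [action] at this
    linarith
  have hs : spin j (κ j) γ τ = c * eta (flowTime j (γ τ)) := by
    rw [spin, (h2 _ hκ).deriv, wt, if_pos rfl]
    rw [Complex.normSq_apply] at hn
    simp
    linear_combination (c * eta (flowTime j (γ τ))) * hn
  have hr : rate j (κ j) γ τ = c := by
    rw [rate, h1.deriv, hs]
    ring
  refine ⟨by rwa [hr], by rw [hr, hs], h1.congr_deriv (by rw [hr]; ring), fun k hk => ?_⟩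
  refine (h2 k hk).congr_deriv ?_
  rw [hs]
  push_cast
  ring

lemma eventually_trapped (h : IsCharacteristic κ γ) (hκ : κ j ≠ j) (hτ : γ τ ∈ trapped j) :
    ∀ᶠ σ in 𝓝 τ, γ σ ∈ trapped j := by
  obtain ⟨hd, ha, ht⟩ := hτ
  have hev : ∀ᶠ σ in 𝓝 τ, γ σ ∈ dom j ∧ ∀ k ≠ j, action (trans j (γ σ)) k = 0 := by
    filter_upwards [h.eventually_mem_dom hd, h.eventually_action_eq hd] with σ h1 h2
    exact ⟨h1, fun k hk => by rw [h2 k hk, ha k hk]⟩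
  have hc : ContinuousAt (fun s => flowTime j (γ s)) τ :=
    ContinuousAt.comp (contDiffAt_flowTime (m := 0) hd.1).continuousAt
      h.smooth.continuous.continuousAt
  rcases lt_or_eq_of_le ht with ht | ht
  · filter_upwards [hev, hc.abs.eventually_lt continuousAt_const ht] with σ h1 h2
    exact ⟨h1.1, h1.2, h2.le⟩
  · have hode := eventually_eq_of_hasDerivAt (f := fun s => flowTime j (γ s))
      (c := fun s => -rate j (κ j) γ s) (w := fun t => 1 - eta t ^ 2) (τ₀ := τ)
      (contDiff_const.sub (contDiff_eta.pow 2))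
      (by rw [eta_sq_of_abs_eq_half ht, sub_self]) (h.continuousAt_rate hd).neg
      (hev.mono fun σ hσ => (h.velocity_of_action_eq_zero hκ hσ.1 hσ.2).2.2.1) rfl
    filter_upwards [hev, hode] with σ h1 h2
    exact ⟨h1.1, h1.2, by rw [h2, ht]⟩

lemma trapped_of_frequently (hn : 3 ≤ n) (h : IsCharacteristic κ γ)
    (hτ : ∃ᶠ σ in 𝓝 τ, γ σ ∈ trapped j) : γ τ ∈ trapped j := by
  have hγ := h.smooth.continuous.continuousAt (x := τ)
  by_cases hd : γ τ ∈ dom j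
  · refine ⟨hd, fun k hk => ?_, ?_⟩
    · by_contra h0
      have := (ContinuousAt.comp (continuousAt_action (k := k) hd.1) hγ).eventually_ne h0
      obtain ⟨σ, h1, h2⟩ := (hτ.and_eventually this).exists
      exact h2 (h1.2.1 k hk)
    · by_contra! h0
      have hc : ContinuousAt (fun s => flowTime j (γ s)) τ :=
        ContinuousAt.comp (contDiffAt_flowTime (m := 0) hd.1).continuousAt hγ
      obtain ⟨σ, h1, h2⟩ := (hτ.and_eventually
        (continuousAt_const.eventually_lt hc.abs h0)).exists
      exact absurd h1.2.2 (not_le.2 h2)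
  · obtain ⟨σ, h1, h2⟩ := (hτ.and_eventually
      (hγ.eventually (eventually_of_not_mem_dom hn hd))).exists
    rcases h2 (h.energy_ge σ) h1.1 with h3 | ⟨k, hk, h3⟩
    · linarith [h1.2.2]
    · rw [h1.2.1 k hk, abs_zero] at h3
      norm_num at h3

lemma forall_trapped (hn : 3 ≤ n) (h : IsCharacteristic κ γ) (hκ : κ j ≠ j)
    (hτ : γ τ ∈ trapped j) (σ : ℝ) : γ σ ∈ trapped j := by
  have h1 : IsClopen {σ | γ σ ∈ trapped j} :=
    ⟨isClosed_iff_frequently.2 fun x hx => h.trapped_of_frequently hn hx,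
      isOpen_iff_mem_nhds.2 fun x hx => h.eventually_trapped hκ hx⟩
  have h2 := h1.eq_univ ⟨τ, hτ⟩
  exact h2.ge (mem_univ σ)

lemma not_trapped (hn : 3 ≤ n) (h : IsCharacteristic κ γ) (hκ : κ j ≠ j) (hT : 0 < T)
    (hp : ∀ t, γ (t + T) = γ t) (τ : ℝ) : γ τ ∉ trapped j := by
  intro hτ
  have htr := h.forall_trapped hn hκ hτ
  have hv := fun σ => h.velocity_of_action_eq_zero hκ (htr σ).1 (htr σ).2.1
  have hrc : Continuous (rate j (κ j) γ) :=
    continuous_iff_continuousAt.2 fun σ => h.continuousAt_rate (htr σ).1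
  have hsc : Continuous (spin j (κ j) γ) :=
    continuous_iff_continuousAt.2 fun σ => h.continuousAt_spin (htr σ).1
  have hη : ∀ σ, eta (flowTime j (γ σ)) ^ 2 = 1 := by
    intro σ
    have h1 := deriv_eq_zero_of_periodic hT (f := fun s => flowTime j (γ s))
      (c := fun s => -rate j (κ j) γ s) (w := fun s => 1 - eta (flowTime j (γ s)) ^ 2)
      (fun t => by rw [hp]) (fun t => (hv t).2.2.1) hrc.neg (fun t => neg_ne_zero.2 (hv t).1)
      (fun t => sub_nonneg.2 (eta_sq_le _)) σ
    have h2 := (mul_eq_zero.1 h1).resolve_left (neg_ne_zero.2 (hv σ).1)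
    linarith
  have hs0 : ∀ σ, spin j (κ j) γ σ ≠ 0 := by
    intro σ
    rw [(hv σ).2.1]
    refine mul_ne_zero (hv σ).1 fun h0 => ?_
    have := hη σ
    rw [h0] at this
    norm_num at this
  have hu0 : ∀ k ≠ j, trans j (γ 0) k ≠ 0 := fun k hk h0 => by
    have := (htr 0).2.1 k hk
    rw [action, h0] at this
    norm_num at this
  obtain ⟨k₂, hk₂⟩ : ∃ k₂, k₂ ∉ ({j, κ j} : Finset (Fin n)) := by
    by_contra! hall
    have h1 : Finset.univ ⊆ ({j, κ j} : Finset (Fin n)) := fun k _ => hall k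
    have h2 := Finset.card_le_card h1
    rw [Finset.card_univ, Fintype.card_fin] at h2
    have h3 := Finset.card_le_two (a := j) (b := κ j)
    omega
  simp only [Finset.mem_insert, Finset.mem_singleton, not_or] at hk₂
  have hpT : ∀ k, trans j (γ T) k = trans j (γ 0) k := fun k => by
    rw [← hp 0, zero_add]
  obtain ⟨a, b, ha, hb, hab⟩ := exists_int_mul_eq_of_periodic hsc hs0 hT
    (show wt (κ j) (κ j) ≠ 0 by simp [wt]) (show wt (κ j) k₂ ≠ 0 by simp [wt, hk₂.2])
    (fun t => (hv t).2.2.2 (κ j) hκ) (hu0 _ hκ) (hpT _)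
    (fun t => (hv t).2.2.2 k₂ hk₂.1) (hu0 _ hk₂.1) (hpT _)
  rw [wt, wt, if_pos rfl, if_neg hk₂.2, one_mul] at hab
  refine (irrational_sqrt_two.mul_intCast hb) ⟨a, ?_⟩
  rw [← hab]
  simp

end IsCharacteristic

end HamiltonianSeifert

namespace HamiltonianSeifert

open Filter Topology Set
open scoped ContDiff RealInnerProductSpace ComplexConjugate

/-! ### The rotation caused by a plug -/

variable {n : ℕ} {j k₁ : Fin n} {κ : Fin n → Fin n} {γ : ℝ → EuclideanSpace ℂ (Fin n)} {τ T : ℝ}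

/-- The argument of the profile function, as a function of time, along an orbit with actions `d`. -/
noncomputable def orbitArg (j k₁ : Fin n) (d : Fin n → ℝ) (s : ℝ) : ℝ :=
  sol (rad n) (eta s ^ 2 * bump j k₁ d) (lin j k₁ d)

/-- The rate of rotation of the transverse coordinate of index `k` with respect to the flow time. -/
noncomputable def drift (j k₁ : Fin n) (d : Fin n → ℝ) (k : Fin n) (s : ℝ) : ℝ :=
  slope j k₁ (eta s) (orbitArg j k₁ d s) d k / slopeH j k₁ (eta s) (orbitArg j k₁ d s) d

/-- The total rotation of the transverse coordinate of index `k` up to time `t`. By symmetry of the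
plug, it only depends on `|t|`. -/
noncomputable def twist (j k₁ : Fin n) (d : Fin n → ℝ) (k : Fin n) (t : ℝ) : ℝ :=
  ∫ s in (-1 : ℝ)..(-|t|), drift j k₁ d k s

lemma orbitArg_spec (d : Fin n → ℝ) (s : ℝ) : orbitArg j k₁ d s -
    eta s ^ 2 * bump j k₁ d * psi (rad n) (orbitArg j k₁ d s) = lin j k₁ d :=
  sol_spec (rad_pos j) (mul_nonneg (sq_nonneg _) (bump_nonneg _))
    (mul_le_one₀ (eta_sq_le _) (bump_nonneg _) (bump_le_one _)) _

lemma continuous_orbitArg (d : Fin n → ℝ) : Continuous (orbitArg j k₁ d) :=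
  continuous_sol (rad_pos j) ((continuous_eta.pow 2).mul continuous_const)
    (fun _ => mul_nonneg (sq_nonneg _) (bump_nonneg _))
    fun _ => mul_le_one₀ (eta_sq_le _) (bump_nonneg _) (bump_le_one _)

lemma orbitArg_neg (d : Fin n → ℝ) (s : ℝ) : orbitArg j k₁ d (-s) = orbitArg j k₁ d s := by
  rw [orbitArg, eta_neg, neg_sq, orbitArg]

lemma slopeH_orbitArg_ne_zero (h1 : k₁ ≠ j) {d : Fin n → ℝ} {s : ℝ}
    (h : (∃ k ≠ j, d k ≠ 0) ∨ |s| ≠ 1 / 2) :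
    slopeH j k₁ (eta s) (orbitArg j k₁ d s) d ≠ 0 := by
  intro h0
  obtain ⟨he, hb, hy, hd⟩ := slopeH_eq_zero (eta_sq_le _) h0
  rcases h with ⟨k, hk, hk'⟩ | h
  · have h2 := orbitArg_spec (j := j) (k₁ := k₁) d s
    rw [hy, psi_zero, mul_zero, sub_zero, lin_eq h1, Finset.sum_eq_zero fun l hl =>
      hd l (Finset.ne_of_mem_erase (Finset.mem_of_mem_erase hl)) (Finset.ne_of_mem_erase hl),
      mul_zero, add_zero] at h2
    by_cases hkk : k = k₁
    · exact hk' (hkk ▸ h2.symm)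
    · exact hk' (hd k hk hkk)
  · exact h (abs_eq_half_of_eta_sq he)

lemma drift_neg (d : Fin n → ℝ) (k : Fin n) (s : ℝ) :
    drift j k₁ d k (-s) = -drift j k₁ d k s := by
  rw [drift, drift, orbitArg_neg, eta_neg, slope, slope, slopeH, slopeH]
  ring

lemma drift_of_eta_eq_zero {d : Fin n → ℝ} {k : Fin n} {s : ℝ} (hs : eta s = 0) :
    drift j k₁ d k s = 0 := by
  simp [drift, slope, hs]

lemma rad_le_abs_orbitArg {d : Fin n → ℝ} (h : 2 * rad n ≤ |lin j k₁ d|) (s : ℝ) :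
    rad n ≤ |orbitArg j k₁ d s| := by
  have h4 : |eta s ^ 2 * bump j k₁ d * psi (rad n) (orbitArg j k₁ d s)| ≤ rad n := by
    have h5 : 0 ≤ eta s ^ 2 * bump j k₁ d := mul_nonneg (sq_nonneg _) (bump_nonneg _)
    rw [abs_mul, abs_of_nonneg h5]
    exact (mul_le_of_le_one_left (abs_nonneg _)
      (mul_le_one₀ (eta_sq_le _) (bump_nonneg _) (bump_le_one _))).trans (abs_psi_le (rad_pos j) _)
  have h5 := abs_sub (orbitArg j k₁ d s)
    (eta s ^ 2 * bump j k₁ d * psi (rad n) (orbitArg j k₁ d s))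
  rw [orbitArg_spec] at h5
  linarith

lemma drift_eq_zero (hn : 3 ≤ n) (h1 : k₁ ≠ j) {d : Fin n → ℝ} (hd : ∃ k ≠ j, 1 / 4 < |d k|)
    (k : Fin n) (s : ℝ) : drift j k₁ d k s = 0 := by
  have hρ := rad_pos j
  have hs : slope j k₁ (eta s) (orbitArg j k₁ d s) d k = 0 := by
    rcases off_support hn h1 hd with h | h
    · simp [slope, dbump, bump, beta_eq_zero h, deriv_beta_eq_zero h]
    · have h3 := rad_le_abs_orbitArg h s
      simp [slope, psi_eq_zero hρ h3, dpsi_eq_zero hρ h3]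
  rw [drift, hs, zero_div]

lemma drift_congr {d d' : Fin n → ℝ} (h : ∀ k ≠ j, d k = d' k) {k : Fin n} (hk : k ≠ j) :
    drift j k₁ d k = drift j k₁ d' k := by
  have hb : bump j k₁ d = bump j k₁ d' := bump_congr fun l hl _ => h l hl
  have hs : sqSum j k₁ d = sqSum j k₁ d' := by
    refine Finset.sum_congr rfl fun l hl => ?_
    rw [h l (Finset.ne_of_mem_erase (Finset.mem_of_mem_erase hl))]
  ext s
  simp only [drift, orbitArg, slope, slopeH, dbump, hb, hs, lin_congr h, h k hk]

lemma twist_congr {d d' : Fin n → ℝ} (h : ∀ k ≠ j, d k = d' k) {k : Fin n} (hk : k ≠ j) :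
    twist j k₁ d k = twist j k₁ d' k := by
  ext t
  rw [twist, twist, drift_congr h hk]

lemma continuousOn_drift (h1 : k₁ ≠ j) {d : Fin n → ℝ} (k : Fin n) {S : Set ℝ}
    (hS : ∀ s ∈ S, (∃ k ≠ j, d k ≠ 0) ∨ |s| ≠ 1 / 2) : ContinuousOn (drift j k₁ d k) S := by
  have hY := continuous_orbitArg (j := j) (k₁ := k₁) d
  have hp := continuous_psi (ρ := rad n)
  have hdp := continuous_dpsi (ρ := rad n)
  have he := continuous_eta
  refine ContinuousOn.div ?_ ?_ fun s hs => slopeH_orbitArg_ne_zero h1 (hS s hs)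
  · unfold slope
    fun_prop
  · unfold slopeH
    fun_prop

lemma hasDerivAt_twist (h1 : k₁ ≠ j) {d : Fin n → ℝ} (k : Fin n) {t : ℝ}
    (h : (∃ k ≠ j, d k ≠ 0) ∨ 1 / 2 < |t|) :
    HasDerivAt (twist j k₁ d k) (drift j k₁ d k t) t := by
  have hz : ∀ s, |s| ≤ 1 / 4 → drift j k₁ d k s = 0 := fun s hs =>
    drift_of_eta_eq_zero (eta_eq_zero_of_ge hs)
  rcases h with h | h
  · exact hasDerivAt_integral_neg_abs (b := 1) (drift_neg d k) hz (by norm_num)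
      (by linarith [abs_nonneg t]) (continuousOn_drift h1 k fun s _ => Or.inl h)
  · refine hasDerivAt_integral_neg_abs (b := -1 / 2) (drift_neg d k) hz (by norm_num)
      (by linarith) (continuousOn_drift h1 k fun s hs => Or.inr ?_)
    have hs' : s < -1 / 2 := hs
    rw [abs_of_neg (by linarith)]
    linarith

lemma twist_eq_zero (hn : 3 ≤ n) (h1 : k₁ ≠ j) {d : Fin n → ℝ} (k : Fin n) {t : ℝ}
    (h : 3 / 4 ≤ |t| ∨ ∃ k ≠ j, 1 / 4 < |d k|) : twist j k₁ d k t = 0 := by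
  rw [twist, intervalIntegral.integral_congr (g := fun _ => 0), intervalIntegral.integral_zero]
  intro s hs
  rcases h with h | h
  · refine drift_of_eta_eq_zero (eta_eq_zero_of_le ?_)
    have h2 : s ≤ max (-1) (-|t|) := hs.2
    have h3 : s ≤ -(3 / 4) := h2.trans (max_le (by norm_num) (by linarith))
    rw [abs_of_neg (by linarith)]
    linarith
  · exact drift_eq_zero hn h1 h k s

/-! ### Straightening of characteristics -/

/-- The transverse coordinates, with the rotation caused by the plug undone. -/
noncomputable def untwist (j k₁ : Fin n) (q : EuclideanSpace ℂ (Fin n)) (k : Fin n) : ℂ :=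
  Complex.exp ((-twist j k₁ (action (trans j q)) k (flowTime j q) : ℝ) * Complex.I) * trans j q k

open Classical in
/-- The map which sends characteristics which are not trapped to orbits on the ellipsoid. -/
noncomputable def straight (κ : Fin n → Fin n) (q : EuclideanSpace ℂ (Fin n)) :
    EuclideanSpace ℂ (Fin n) :=
  if h : ∃ j, q ∈ dom j then chart h.choose (flowTime h.choose q) 0 (untwist h.choose (κ h.choose) q)
  else q

lemma straight_of_mem (hn : 3 ≤ n) {q : EuclideanSpace ℂ (Fin n)} (he : -1 ≤ energy q)
    (hq : q ∈ dom j) : straight κ q = chart j (flowTime j q) 0 (untwist j (κ j) q) := by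
  have h : ∃ j, q ∈ dom j := ⟨j, hq⟩
  rw [straight, dif_pos h, eq_of_mem_dom hn he h.choose_spec hq]

lemma straight_of_notMem {q : EuclideanSpace ℂ (Fin n)} (hq : ∀ j, q ∉ dom j) :
    straight κ q = q := by
  rw [straight, dif_neg (by simpa using hq)]

lemma action_untwist (q : EuclideanSpace ℂ (Fin n)) (k : Fin n) :
    action (untwist j k₁ q) k = action (trans j q) k := by
  rw [action, untwist, normSq_exp_mul_I, action]

lemma axisSq_untwist_pos {q : EuclideanSpace ℂ (Fin n)} (hq : q ∈ dom j) :
    0 < axisSq j 0 (untwist j k₁ q) :=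
  axisSq_pos (by norm_num) fun k hk => by
    rw [action_untwist]
    exact hq.2 k hk

namespace IsCharacteristic

lemma hasDerivAt_untwist (h : IsCharacteristic κ γ) (hκ : κ j ≠ j) (hτ : γ τ ∈ dom j)
    (hnt : γ τ ∉ trapped j) : deriv (fun s => flowTime j (γ s)) τ ≠ 0 ∧
      ∀ k ≠ j, HasDerivAt (fun s => untwist j (κ j) (γ s) k) 0 τ := by
  obtain ⟨c, hc, h1, h2⟩ := h.exists_velocity hτ
  have hor : (∃ k ≠ j, action (trans j (γ τ)) k ≠ 0) ∨ 1 / 2 < |flowTime j (γ τ)| := by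
    by_contra! hc
    exact hnt ⟨hτ, hc⟩
  rw [h.levelArg_eq_sol hτ] at h1 h2
  have hH := slopeH_orbitArg_ne_zero hκ (hor.imp_right ne_of_gt)
  rw [orbitArg] at hH
  refine ⟨by rw [h1.deriv]; exact neg_ne_zero.2 (mul_ne_zero hc hH), fun k hk => ?_⟩
  have h3 := (hasDerivAt_twist hκ k hor).comp τ h1
  have h4 := (h3.fun_neg.ofReal_comp.mul_const Complex.I).cexp.fun_mul (h2 k hk)
  refine HasDerivAt.congr_deriv (h4.congr_of_eventuallyEq ?_) ?_
  · filter_upwards [h.eventually_action_eq hτ] with σ hσ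
    simp only [untwist, twist_congr hσ hk, Function.comp]
  · simp only [drift, orbitArg]
    push_cast
    generalize slopeH j _ _ _ _ = H at hH
    have hH' : (H : ℂ) ≠ 0 := Complex.ofReal_ne_zero.2 hH
    field_simp
    ring

/-- Locally, a straightened characteristic moves along an orbit on the ellipsoid. -/
lemma eventually_straight_eq (hn : 3 ≤ n) (h : IsCharacteristic κ γ) (hκ : κ j ≠ j)
    (hτ : γ τ ∈ dom j) (hnt : ∀ σ, γ σ ∉ trapped j) :
    (fun σ => straight κ (γ σ)) =ᶠ[𝓝 τ]
      fun σ => chart j (flowTime j (γ σ)) 0 (untwist j (κ j) (γ τ)) := by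
  have hw : ∀ᶠ σ in 𝓝 τ, ∀ k ≠ j, untwist j (κ j) (γ σ) k = untwist j (κ j) (γ τ) k := by
    refine eventually_all.2 fun k => eventually_imp_distrib_left.2 fun hk => ?_
    exact eventually_eq_of_eventually_hasDerivAt_zero
      ((h.eventually_mem_dom hτ).mono fun σ hσ => (h.hasDerivAt_untwist hκ hσ (hnt σ)).2 k hk)
  filter_upwards [hw, h.eventually_mem_dom hτ] with σ h1 h2
  rw [straight_of_mem hn (h.energy_ge σ) h2, chart_congr h1]

lemma straight_eq_self (hn : 3 ≤ n) (h : IsCharacteristic κ γ) (hκ : κ j ≠ j)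
    (hτ : γ τ ∈ dom j)
    (hc : 3 / 4 ≤ |flowTime j (γ τ)| ∨ ∃ k ≠ j, 1 / 4 < |action (trans j (γ τ)) k|) :
    straight κ (γ τ) = γ τ := by
  have he : energy (γ τ) = 0 := by
    rw [h.energy_eq_prof hτ]
    rcases hc with h1 | h1
    · simp [prof, eta_eq_zero_of_le h1]
    · rcases off_support hn hκ h1 with h2 | h2
      · simp [prof, bump, beta_eq_zero h2]
      · rw [h.levelArg_eq_sol hτ, ← orbitArg]
        simp [prof, psi_eq_zero (rad_pos j) (rad_le_abs_orbitArg h2 _)]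
  rw [straight_of_mem hn (h.energy_ge τ) hτ, chart_congr (u' := trans j (γ τ)) fun k _ => by
    rw [untwist, twist_eq_zero hn hκ k hc]; simp]
  have h2 := chart_trans j (γ τ)
  rwa [he] at h2

lemma eventually_straight_eq_self (hn : 3 ≤ n) (h : IsCharacteristic κ γ) (hκ : ∀ j, κ j ≠ j)
    (hτ : ∀ j, γ τ ∉ dom j) : (fun σ => straight κ (γ σ)) =ᶠ[𝓝 τ] γ := by
  have h1 : ∀ᶠ σ in 𝓝 τ, ∀ j, -1 ≤ energy (γ σ) → γ σ ∈ dom j →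
      3 / 4 ≤ |flowTime j (γ σ)| ∨ ∃ k ≠ j, 1 / 4 < |action (trans j (γ σ)) k| :=
    eventually_all.2 fun j => h.smooth.continuous.continuousAt.eventually
      (eventually_of_not_mem_dom hn (hτ j))
  filter_upwards [h1] with σ hσ
  by_cases hd : ∃ j, γ σ ∈ dom j
  · obtain ⟨j, hj⟩ := hd
    exact h.straight_eq_self hn (hκ j) hj (hσ j (h.energy_ge σ) hj)
  · exact straight_of_notMem (by simpa using hd)

lemma contDiff_straight (hn : 3 ≤ n) (h : IsCharacteristic κ γ) (hκ : ∀ j, κ j ≠ j)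
    (hnt : ∀ j σ, γ σ ∉ trapped j) : ContDiff ℝ 1 fun σ => straight κ (γ σ) := by
  refine contDiff_iff_contDiffAt.2 fun τ => ?_
  by_cases hd : ∃ j, γ τ ∈ dom j
  · obtain ⟨j, hj⟩ := hd
    refine ContDiffAt.congr_of_eventuallyEq ?_ (h.eventually_straight_eq hn (hκ j) hj (hnt j))
    exact contDiffAt_chart ((contDiffAt_flowTime hj.1).comp τ h.smooth.contDiffAt)
      contDiffAt_const (fun _ _ => contDiffAt_const) (axisSq_untwist_pos hj)
  · exact h.smooth.contDiffAt.congr_of_eventuallyEq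
      (h.eventually_straight_eq_self hn hκ (by simpa using hd))

lemma energy_straight (hn : 3 ≤ n) (h : IsCharacteristic κ γ) (τ : ℝ) :
    energy (straight κ (γ τ)) = 0 := by
  by_cases hd : ∃ j, γ τ ∈ dom j
  · obtain ⟨j, hj⟩ := hd
    rw [straight_of_mem hn (h.energy_ge τ) hj, energy_chart (axisSq_untwist_pos hj).le]
  · have hd' : ∀ j, γ τ ∉ dom j := by simpa using hd
    rw [straight_of_notMem hd', h.energy_eq τ hd']

lemma exists_deriv_straight (hn : 3 ≤ n) (h : IsCharacteristic κ γ) (hκ : ∀ j, κ j ≠ j)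
    (hnt : ∀ j σ, γ σ ∉ trapped j) (τ : ℝ) : ∃ m : ℝ, m ≠ 0 ∧ ∀ k,
      deriv (fun σ => straight κ (γ σ)) τ k =
        ((freq k * m : ℝ) : ℂ) * Complex.I * straight κ (γ τ) k := by
  by_cases hd : ∃ j, γ τ ∈ dom j
  · obtain ⟨j, hj⟩ := hd
    refine ⟨_, (h.hasDerivAt_untwist (hκ j) hj (hnt j τ)).1, fun k => ?_⟩
    have hev := h.eventually_straight_eq hn (hκ j) hj (hnt j)
    have hp := axisSq_untwist_pos (k₁ := κ j) hj
    have ht : DifferentiableAt ℝ (fun s => flowTime j (γ s)) τ :=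
      ((contDiffAt_flowTime (m := 1) hj.1).comp τ h.smooth.contDiffAt).differentiableAt (by simp)
    obtain ⟨V, hV, r', hr, hVj, hVk⟩ := exists_isChartVelocity ht.hasDerivAt
      (hasDerivAt_const τ (0 : ℝ)) (u' := 0)
      (fun k _ => hasDerivAt_const τ (untwist j (κ j) (γ τ) k)) hp
    have hr0 : r' = 0 := by
      have hf := freq_pos j
      have : 0 < freq j * √(2 / freq j * axisSq j 0 (untwist j (κ j) (γ τ))) := by positivity
      simpa [this.ne'] using hr
    rw [hev.deriv_eq, hV.deriv, hev.eq_of_nhds]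
    by_cases hk : k = j
    · subst hk
      rw [hVj, chart_axis, hr0]
      push_cast
      ring
    · rw [hVk k hk, chart_of_ne hk]
      push_cast
      simp
      ring
  · have hd' : ∀ j, γ τ ∉ dom j := by simpa using hd
    obtain ⟨c, hc0, hc⟩ := h.energy_dir τ hd'
    refine ⟨-c, neg_ne_zero.2 hc0, fun k => ?_⟩
    have hev := h.eventually_straight_eq_self hn hκ hd'
    rw [hev.deriv_eq, hev.eq_of_nhds, velocity_of_energy hc k]
    push_cast
    ring

/-- The straightened characteristic is a reparametrized orbit on the ellipsoid. -/
lemma exists_continuous_rate (hn : 3 ≤ n) (h : IsCharacteristic κ γ) (hκ : ∀ j, κ j ≠ j)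
    (hnt : ∀ j σ, γ σ ∉ trapped j) : ∃ ν : ℝ → ℝ, Continuous ν ∧ (∀ τ, ν τ ≠ 0) ∧ ∀ k τ,
      HasDerivAt (fun σ => straight κ (γ σ) k)
        (((freq k * ν τ : ℝ) : ℂ) * Complex.I * straight κ (γ τ) k) τ := by
  have hcd := h.contDiff_straight hn hκ hnt
  set c := fun σ => straight κ (γ σ) with hc
  choose ν hν0 hν using h.exists_deriv_straight hn hκ hnt
  refine ⟨ν, ?_, hν0, fun k τ => ?_⟩
  · have hn0 : (0 : ℝ) < n := by exact_mod_cast (by omega : 0 < n)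
    have key : ν = fun τ => (∑ k, (conj (c τ k) * deriv c τ k).im) / (20 * n) := by
      ext τ
      have h1 : ∀ k, (conj (c τ k) * deriv c τ k).im =
          ν τ * (2 * (freq k * Complex.normSq (c τ k) / 2)) := fun k => by
        rw [hν τ k, Complex.normSq_apply]
        simp [c]
        ring
      have h2 := h.energy_straight hn τ
      rw [energy] at h2
      rw [Finset.sum_congr rfl fun k _ => h1 k, ← Finset.mul_sum, ← Finset.mul_sum]
      field_simp
      linear_combination (-2 * ν τ) * h2
    rw [key]
    have h3 := hcd.continuous_deriv le_rfl
    have h4 := hcd.continuous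
    refine Continuous.div_const (continuous_finsetSum _ fun k _ => ?_) _
    have h5 : Continuous fun τ => c τ k := by fun_prop
    have h6 : Continuous fun τ => deriv c τ k := by fun_prop
    exact Complex.continuous_im.comp ((Complex.continuous_conj.comp h5).mul h6)
  · have h1 : HasDerivAt c (deriv c τ) τ := (hcd.differentiable (by simp) τ).hasDerivAt
    have h2 := ((EuclideanSpace.proj (𝕜 := ℂ) k).restrictScalars ℝ).hasFDerivAt.comp_hasDerivAt τ h1
    exact h2.congr_deriv (hν τ k)

end IsCharacteristic

end HamiltonianSeifert

namespace HamiltonianSeifert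

open Filter Topology Set
open scoped ContDiff RealInnerProductSpace ComplexConjugate

/-! ### Absence of closed characteristics -/

variable {n : ℕ} {j k₁ : Fin n} {κ : Fin n → Fin n} {γ : ℝ → EuclideanSpace ℂ (Fin n)} {τ T : ℝ}

lemma eq_of_freq_mul_int_eq {j l : Fin n} {a b : ℤ} (ha : a ≠ 0)
    (h : freq j * a = freq l * b) : l = j := by
  have h2 := sqrt_two_bounds.1
  have hj : (0 : ℝ) ≤ (j : ℕ) := Nat.cast_nonneg _
  have hl : (0 : ℝ) ≤ (l : ℕ) := Nat.cast_nonneg _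
  have h3 : (a : ℝ) * (√2 + (l : ℕ)) = b * (√2 + (j : ℕ)) := by
    rw [freq, freq, one_div_mul_eq_div, one_div_mul_eq_div,
      div_eq_div_iff (by linarith) (by linarith)] at h
    exact h
  have hab : a = b := by
    by_contra hne
    refine irrational_sqrt_two.mul_intCast (sub_ne_zero.2 hne)
      ⟨((b * (j : ℕ) - a * (l : ℕ) : ℤ) : ℚ), ?_⟩
    push_cast
    linear_combination -h3
  rw [← hab] at h3
  have h4 := mul_left_cancel₀ (Int.cast_ne_zero.2 ha) h3
  refine Fin.ext ?_
  exact_mod_cast add_left_cancel h4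

lemma trans_of_eq_zero {z : EuclideanSpace ℂ (Fin n)} {k : Fin n} (hz : z k = 0) :
    trans j z k = 1 := by
  simp [trans, hz]

lemma action_of_eq_one {u : Fin n → ℂ} {k : Fin n} (hu : u k = 1) : action u k = 0 := by
  simp [action, hu]

namespace IsCharacteristic

lemma not_periodic (hn : 3 ≤ n) (h : IsCharacteristic κ γ) (hκ : ∀ j, κ j ≠ j) (hT : 0 < T)
    (hp : ∀ t, γ (t + T) = γ t) : False := by
  have hnt : ∀ j σ, γ σ ∉ trapped j := fun j σ => h.not_trapped hn (hκ j) hT hp σ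
  obtain ⟨ν, hνc, hν0, hν⟩ := h.exists_continuous_rate hn hκ hnt
  have hcT : ∀ k, straight κ (γ T) k = straight κ (γ 0) k := fun k => by rw [← hp 0, zero_add]
  obtain ⟨j, hj⟩ : ∃ j, straight κ (γ 0) j ≠ 0 := by
    by_contra! h0
    have h1 := h.energy_straight hn 0
    have hn0 : (0 : ℝ) < n := by exact_mod_cast (by omega : 0 < n)
    simp only [energy, h0, map_zero, mul_zero, zero_div, Finset.sum_const_zero] at h1
    linarith
  have hother : ∀ l ≠ j, ∀ t, straight κ (γ t) l = 0 := by
    intro l hl t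
    have h0 : straight κ (γ 0) l = 0 := by
      by_contra h0
      obtain ⟨a, b, ha, -, hab⟩ := exists_int_mul_eq_of_periodic hνc hν0 hT (freq_pos j).ne'
        (freq_pos l).ne' (hν j) hj (hcT j) (hν l) h0 (hcT l)
      exact hl (eq_of_freq_mul_int_eq ha hab)
    rw [eq_mul_exp_of_hasDerivAt hνc (hν l) t, h0, zero_mul]
  obtain ⟨τ, hτ⟩ := exists_eq_norm_of_periodic hνc hν0 hT (freq_pos j).ne' (hν j) hj (hcT j)
  have hpos : 0 < ‖straight κ (γ 0) j‖ := norm_pos_iff.2 hj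
  by_cases hd : ∃ l, γ τ ∈ dom l
  · obtain ⟨l, hl⟩ := hd
    have hst := straight_of_mem (κ := κ) hn (h.energy_ge τ) hl
    have hax := axisSq_untwist_pos (k₁ := κ l) hl
    have hft := abs_freq_mul_flowTime_lt hl.1
    have hlj : l = j := by
      by_contra hne
      have h1 := re_chart_pos hax hft
      rw [← hst, hother l hne] at h1
      simp at h1
    subst hlj
    refine hnt l τ ⟨hl, fun k hk => ?_, ?_⟩
    · rw [← action_untwist (k₁ := κ l)]
      refine action_of_eq_one ?_
      rw [← trans_chart hax hft hk, ← hst]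
      exact trans_of_eq_zero (hother k hk τ)
    · rw [← flowTime_chart hax hft, ← hst, flowTime, hτ, Complex.arg_ofReal_of_nonneg hpos.le]
      norm_num
  · have hd' : ∀ l, γ τ ∉ dom l := by simpa using hd
    rw [straight_of_notMem hd'] at hτ
    refine hd' j ⟨by rw [hτ]; simpa using hj, fun k hk => ?_⟩
    rw [action_of_eq_one (trans_of_eq_zero ?_)]
    · norm_num
    · rw [← hother k hk τ, straight_of_notMem hd']

end IsCharacteristic

lemma isCharacteristic_of_embed (hn : 3 ≤ n) (hκ : ∀ j, κ j ≠ j) (hγ : ContDiff ℝ 1 γ)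
    (hmem : ∀ t, γ t ∈ embed κ '' Metric.sphere (0 : EuclideanSpace ℂ (Fin n)) 1)
    (h0 : ∀ t, deriv γ t ≠ 0)
    (hω : ∀ (t : ℝ) (x : EuclideanSpace ℂ (Fin n)),
      x ∈ Metric.sphere (0 : EuclideanSpace ℂ (Fin n)) 1 → embed κ x = γ t →
      ∀ v : EuclideanSpace ℂ (Fin n), ⟪v, x⟫ = 0 →
        stdSymp n (deriv γ t) (fderiv ℝ (embed κ) x v) = 0) : IsCharacteristic κ γ := by
  have hmem' : ∀ t, ∃ x : EuclideanSpace ℂ (Fin n), ‖x‖ = 1 ∧ embed κ x = γ t := fun t => by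
    obtain ⟨x, hx, hxt⟩ := hmem t
    exact ⟨x, mem_sphere_zero_iff_norm.1 hx, hxt⟩
  have hge : ∀ τ, -1 ≤ energy (γ τ) := fun τ => by
    obtain ⟨x, hx, hxt⟩ := hmem' τ
    rw [← hxt]
    exact neg_one_le_energy_embed hn hκ hx
  have hlev : ∀ τ j, γ τ ∈ dom j → level j (κ j) (γ τ) = 0 := fun τ j hj => by
    obtain ⟨x, hx, hxt⟩ := hmem' τ
    rw [← hxt] at hj ⊢
    exact (eventually_level_embed hn hκ hx hj).self_of_nhds
  have hen : ∀ τ, (∀ j, γ τ ∉ dom j) → energy (γ τ) = 0 := fun τ hj => by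
    obtain ⟨x, hx, hxt⟩ := hmem' τ
    rw [← hxt] at hj ⊢
    exact (eventually_energy_embed hn hκ hx hj).self_of_nhds
  have hmul : ∀ (τ : ℝ) (K : EuclideanSpace ℂ (Fin n) → ℝ), DifferentiableAt ℝ K (γ τ) →
      fderiv ℝ K (γ τ) ≠ 0 → (∀ x : EuclideanSpace ℂ (Fin n), ‖x‖ = 1 → embed κ x = γ τ →
        ∀ᶠ y in 𝓝 x, K (embed κ y) = 0) →
      ∃ c : ℝ, c ≠ 0 ∧ ∀ v, stdSymp n (deriv γ τ) v = c * fderiv ℝ K (γ τ) v := by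
    intro τ K hK hK0 hev
    obtain ⟨x, hx, hxt⟩ := hmem' τ
    refine exists_multiplier hx ((contDiff_embed (m := 1) hn hκ).differentiable (by simp) x)
      (fun v hv hv0 => fderiv_embed_ne_zero hn hκ hx hv hv0) (hxt ▸ hK.hasFDerivAt)
      (hev x hx hxt) hK0 (h0 τ) (hω τ x (mem_sphere_zero_iff_norm.2 hx) hxt)
  refine ⟨hγ, hge, hlev, hen, fun τ j hj => ?_, fun τ hj => ?_⟩
  · exact hmul τ _ ((contDiffAt_level (m := 1) hj.1).differentiableAt (by simp))
      (fderiv_level_ne_zero (hκ j) hj (hge τ))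
      fun x hx hxt => eventually_level_embed hn hκ hx (by rwa [hxt])
  · exact hmul τ _ ((contDiff_energy (m := 1)).differentiable (by simp) _)
      (fderiv_energy_ne_zero (hen τ hj) hn)
      fun x hx hxt => eventually_energy_embed hn hκ hx (by rwa [hxt])

end HamiltonianSeifert

/-- **Ginzburg–Herman counterexample to the Hamiltonian Seifert conjecture**: for
`2n ≥ 6` there is a `C^∞` embedding of `S^{2n-1}` into `ℝ^{2n} = ℂ^n` (realized as the
restriction to the unit sphere of a smooth map `F` which is injective and immersive on
the sphere) whose image carries no closed characteristic of the restriction of the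
standard symplectic form. -/
theorem hamiltonian_seifert_counterexample_sphere (n : ℕ) (hn : 3 ≤ n) :
    ∃ F : EuclideanSpace ℂ (Fin n) → EuclideanSpace ℂ (Fin n),
      ContDiff ℝ (⊤ : ℕ∞) F ∧
      Set.InjOn F (Metric.sphere (0 : EuclideanSpace ℂ (Fin n)) 1) ∧
      (∀ x ∈ Metric.sphere (0 : EuclideanSpace ℂ (Fin n)) 1,
        ∀ v : EuclideanSpace ℂ (Fin n), ⟪v, x⟫ = 0 → v ≠ 0 → fderiv ℝ F x v ≠ 0) ∧
      ¬ ∃ γ : ℝ → EuclideanSpace ℂ (Fin n),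
          ContDiff ℝ (⊤ : ℕ∞) γ ∧
          (∀ t, γ t ∈ F '' Metric.sphere (0 : EuclideanSpace ℂ (Fin n)) 1) ∧
          (∀ t, deriv γ t ≠ 0) ∧
          (∃ T > 0, ∀ t, γ (t + T) = γ t) ∧
          (∃ t s, γ t ≠ γ s) ∧
          (∀ (t : ℝ) (x : EuclideanSpace ℂ (Fin n)),
            x ∈ Metric.sphere (0 : EuclideanSpace ℂ (Fin n)) 1 → F x = γ t →
            ∀ v : EuclideanSpace ℂ (Fin n), ⟪v, x⟫ = 0 →
              stdSymp n (deriv γ t) (fderiv ℝ F x v) = 0) := by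
  have : Nontrivial (Fin n) := Fin.nontrivial_iff_two_le.2 (by omega)
  choose κ hκ using fun j : Fin n => exists_ne j
  refine ⟨HamiltonianSeifert.embed κ, HamiltonianSeifert.contDiff_embed hn hκ,
    HamiltonianSeifert.injOn_embed hn hκ, fun x hx v hv hv0 =>
      HamiltonianSeifert.fderiv_embed_ne_zero hn hκ (mem_sphere_zero_iff_norm.1 hx) hv hv0, ?_⟩
  rintro ⟨γ, hγ, hmem, h0, ⟨T, hT, hp⟩, -, hω⟩
  exact (HamiltonianSeifert.isCharacteristic_of_embed hn hκ (hγ.of_le (by exact_mod_cast le_top))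
    hmem h0 hω).not_periodic hn hκ hT hp
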